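/- arXiv:2503.09525 — 5 statements merged into one kernel-verified Lean document; each statement's English description precedes it below -/
import Mathlib

section
/- For every d ≥ 1 there exist real constants β, c > 0 such that for every natural number n ≥ 2 there exists a CPA function f : ℝ^d → ℝ that has at most n affine components (i.e., there exist at most n affine functions g_1, …, g_k : ℝ^d → ℝ, k ≤ n, with: for every x there is i with f(x) = g_i(x)) and has at least β · n^{d + 1 − c/√(log₂ n)} pairwise distinct maximal pieces. -/
/-- An affine function `ℝ^d → ℝ`, i.e. a map of the form `x ↦ ⟨a, x⟩ + b`. -/
def IsAffineFn {d : ℕ} (g : (Fin d → ℝ) → ℝ) : Prop :=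
  ∃ (a : Fin d → ℝ) (b : ℝ), ∀ x, g x = (∑ i, a i * x i) + b

/-- `f` agrees with some affine map on the set `P`. -/
def AffineOnSet {d : ℕ} (f : (Fin d → ℝ) → ℝ) (P : Set (Fin d → ℝ)) : Prop :=
  ∃ g : (Fin d → ℝ) → ℝ, IsAffineFn g ∧ ∀ x ∈ P, f x = g x

/-- `Ps` is an admissible (finite) set of pieces for `f`: all pieces are open,
connected, `f` is affine on each of them, and their closures cover `ℝ^d`. -/
def IsPieceSet {d : ℕ} (f : (Fin d → ℝ) → ℝ) (Ps : Finset (Set (Fin d → ℝ))) : Prop :=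
  (∀ P ∈ Ps, IsOpen P ∧ IsConnected P ∧ AffineOnSet f P) ∧
    (⋃ P ∈ Ps, closure P) = Set.univ

/-- A continuous piecewise affine (CPA) function. -/
def IsCPA {d : ℕ} (f : (Fin d → ℝ) → ℝ) : Prop :=
  Continuous f ∧ ∃ Ps : Finset (Set (Fin d → ℝ)), IsPieceSet f Ps

/-- `P` is a maximal piece of `f`: open, connected, `f` affine on `P`, and it cannot
be enlarged by a nonempty set `U ⊆ ℝ^d \ P` keeping openness, connectedness and affineness. -/
def IsMaximalPiece {d : ℕ} (f : (Fin d → ℝ) → ℝ) (P : Set (Fin d → ℝ)) : Prop :=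
  IsOpen P ∧ IsConnected P ∧ AffineOnSet f P ∧
    ¬ ∃ U : Set (Fin d → ℝ), U.Nonempty ∧ U ⊆ Pᶜ ∧ IsOpen (P ∪ U) ∧
      IsConnected (P ∪ U) ∧ AffineOnSet f (P ∪ U)

open Set Filter Topology

theorem IsAffineFn.map_combo {d : ℕ} {g : (Fin d → ℝ) → ℝ} (hg : IsAffineFn g)
    (x y : Fin d → ℝ) {s t : ℝ} (hst : s + t = 1) :
    g (s • x + t • y) = s * g x + t * g y := by
  obtain ⟨a, b, h⟩ := hg
  simp only [h, Pi.add_apply, Pi.smul_apply, smul_eq_mul, mul_add, Finset.sum_add_distrib,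
    Finset.mul_sum]
  have e1 : ∀ i, a i * (s * x i) = s * (a i * x i) := fun i => by ring
  have e2 : ∀ i, a i * (t * y i) = t * (a i * y i) := fun i => by ring
  simp only [e1, e2]
  linear_combination (-b) * hst

theorem IsAffineFn.continuous {d : ℕ} {g : (Fin d → ℝ) → ℝ} (hg : IsAffineFn g) :
    Continuous g := by
  obtain ⟨a, b, h⟩ := hg
  rw [show g = fun x => (∑ i, a i * x i) + b from funext h]
  fun_prop

/-- Affine functions agreeing near a point are equal. -/
theorem IsAffineFn.eq_of_eventuallyEq {d : ℕ} {g g' : (Fin d → ℝ) → ℝ} (hg : IsAffineFn g)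
    (hg' : IsAffineFn g') {x : Fin d → ℝ} (h : g =ᶠ[𝓝 x] g') : g = g' := by
  funext y
  have hc : Tendsto (fun t : ℝ => (1 - t) • x + t • y) (𝓝[≠] 0) (𝓝 x) := by
    have : Continuous fun t : ℝ => (1 - t) • x + t • y := by fun_prop
    have h0 := this.tendsto 0
    simp only [sub_zero, one_smul, zero_smul, add_zero] at h0
    exact h0.mono_left nhdsWithin_le_nhds
  obtain ⟨t, ht, ht0⟩ := ((hc.eventually h).and self_mem_nhdsWithin).exists
  have hx := h.self_of_nhds
  rw [hg.map_combo x y (by ring), hg'.map_combo x y (by ring), hx] at ht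
  exact mul_left_cancel₀ ht0 (by linarith)

/-- The open cell of the arrangement of the hyperplanes `g = g'` (`g, g' ∈ G`) on which the
strict inequalities prescribed by `σ` hold. -/
def arrangementCell {d : ℕ} (G : Finset ((Fin d → ℝ) → ℝ))
    (σ : Set (((Fin d → ℝ) → ℝ) × ((Fin d → ℝ) → ℝ))) : Set (Fin d → ℝ) :=
  {x | ∀ g ∈ G, ∀ g' ∈ G, g ≠ g' → ((g, g') ∈ σ → g x < g' x) ∧ ((g, g') ∉ σ → g' x < g x)}

theorem isOpen_arrangementCell {d : ℕ} {G : Finset ((Fin d → ℝ) → ℝ)}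
    (hG : ∀ g ∈ G, IsAffineFn g) (σ : Set (((Fin d → ℝ) → ℝ) × ((Fin d → ℝ) → ℝ))) :
    IsOpen (arrangementCell G σ) := by
  have : arrangementCell G σ = ⋂ g ∈ G, ⋂ g' ∈ G, {x | g ≠ g' →
      ((g, g') ∈ σ → g x < g' x) ∧ ((g, g') ∉ σ → g' x < g x)} := by
    ext x; simp [arrangementCell]
  rw [this]
  refine isOpen_biInter_finset fun g hg => isOpen_biInter_finset fun g' hg' => ?_
  by_cases h : g = g'
  · simp [h]
  by_cases h' : (g, g') ∈ σ
  · simpa [h, h'] using isOpen_lt (hG g hg).continuous (hG g' hg').continuous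
  · simpa [h, h'] using isOpen_lt (hG g' hg').continuous (hG g hg).continuous

theorem convex_arrangementCell {d : ℕ} {G : Finset ((Fin d → ℝ) → ℝ)}
    (hG : ∀ g ∈ G, IsAffineFn g) (σ : Set (((Fin d → ℝ) → ℝ) × ((Fin d → ℝ) → ℝ))) :
    Convex ℝ (arrangementCell G σ) := by
  have key : ∀ {u u' v v' s t : ℝ}, u < u' → v < v' → 0 ≤ s → 0 ≤ t → s + t = 1 →
      s * u + t * v < s * u' + t * v' := by
    intro u u' v v' s t hu hv hs ht hst
    rcases hs.eq_or_lt with rfl | hs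
    · have : t = 1 := by linarith
      subst this; linarith
    · have h1 := mul_lt_mul_of_pos_left hu hs
      have h2 := mul_le_mul_of_nonneg_left hv.le ht
      linarith
  intro x hx y hy s t hs ht hst g hg g' hg' hne
  rw [(hG g hg).map_combo x y hst, (hG g' hg').map_combo x y hst]
  have hx := hx g hg g' hg' hne
  have hy := hy g hg g' hg' hne
  exact ⟨fun h => key (hx.1 h) (hy.1 h) hs ht hst, fun h => key (hx.2 h) (hy.2 h) hs ht hst⟩

theorem affineOnSet_arrangementCell {d : ℕ} {f : (Fin d → ℝ) → ℝ} (hf : Continuous f)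
    {G : Finset ((Fin d → ℝ) → ℝ)} (hG : ∀ g ∈ G, IsAffineFn g) (hcov : ∀ x, ∃ g ∈ G, f x = g x)
    (σ : Set (((Fin d → ℝ) → ℝ) × ((Fin d → ℝ) → ℝ))) (hne : (arrangementCell G σ).Nonempty) :
    AffineOnSet f (arrangementCell G σ) := by
  classical
  obtain ⟨x₀, hx₀⟩ := hne
  obtain ⟨g₀, hg₀, hfg₀⟩ := hcov x₀
  refine ⟨g₀, hG g₀ hg₀, ?_⟩
  by_contra! hcon
  obtain ⟨x₁, hx₁, hfx₁⟩ := hcon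
  have hpre := (convex_arrangementCell hG σ).isPreconnected
  rw [isPreconnected_closed_iff] at hpre
  obtain ⟨g₁, hg₁, hfg₁⟩ := hcov x₁
  obtain ⟨z, hz, hz₀, hz₁⟩ := hpre {x | f x = g₀ x} (⋃ g ∈ G.erase g₀, {x | f x = g x})
    (isClosed_eq hf (hG g₀ hg₀).continuous)
    ((G.erase g₀).finite_toSet.isClosed_biUnion fun g hg =>
      isClosed_eq hf (hG g (Finset.mem_of_mem_erase hg)).continuous)
    (fun x _ => by
      obtain ⟨g, hg, hfg⟩ := hcov x
      by_cases h : g = g₀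
      · left; rw [← h]; exact hfg
      · right; simp only [mem_iUnion]; exact ⟨g, Finset.mem_erase.2 ⟨h, hg⟩, hfg⟩)
    ⟨x₀, hx₀, hfg₀⟩
    ⟨x₁, hx₁, by
      simp only [mem_iUnion]
      exact ⟨g₁, Finset.mem_erase.2 ⟨fun h => hfx₁ (h ▸ hfg₁), hg₁⟩, hfg₁⟩⟩
  simp only [mem_iUnion] at hz₁
  obtain ⟨g, hg, hzg⟩ := hz₁
  obtain ⟨hgne, hg⟩ := Finset.mem_erase.1 hg
  have h := hz g hg g₀ hg₀ hgne
  have heq : g z = g₀ z := by rw [← show f z = g z from hzg]; exact hz₀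
  by_cases hσ : (g, g₀) ∈ σ
  · exact (h.1 hσ).ne heq
  · exact (h.2 hσ).ne heq.symm

/-- A continuous function that everywhere agrees with one of finitely many affine functions is
CPA. -/
theorem isCPA_of_finset {d : ℕ} {f : (Fin d → ℝ) → ℝ} (hf : Continuous f)
    (G : Finset ((Fin d → ℝ) → ℝ)) (hG : ∀ g ∈ G, IsAffineFn g)
    (hcov : ∀ x, ∃ g ∈ G, f x = g x) : IsCPA f := by
  classical
  refine ⟨hf, ((G ×ˢ G).powerset.image fun σ : Finset (((Fin d → ℝ) → ℝ) × ((Fin d → ℝ) → ℝ)) =>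
    arrangementCell G (σ : Set (((Fin d → ℝ) → ℝ) × ((Fin d → ℝ) → ℝ)))).filter Set.Nonempty,
    ?_, ?_⟩
  · intro P hP
    obtain ⟨hP, hne⟩ := Finset.mem_filter.1 hP
    obtain ⟨σ, -, rfl⟩ := Finset.mem_image.1 hP
    exact ⟨isOpen_arrangementCell hG _, ⟨hne, (convex_arrangementCell hG _).isPreconnected⟩,
      affineOnSet_arrangementCell hf hG hcov _ hne⟩
  · have hdense : Dense (⋂ e ∈ {e : ((Fin d → ℝ) → ℝ) × ((Fin d → ℝ) → ℝ) |
        e.1 ∈ G ∧ e.2 ∈ G ∧ e.1 ≠ e.2}, {x | e.1 x ≠ e.2 x}) := by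
      refine dense_biInter_of_isOpen ?_ ?_ ?_
      · rintro e ⟨h1, h2, -⟩
        exact isOpen_ne_fun (hG _ h1).continuous (hG _ h2).continuous
      · refine ((G ×ˢ G).finite_toSet.subset ?_).countable
        rintro e ⟨h1, h2, -⟩
        simp [h1, h2]
      · rintro e ⟨h1, h2, h3⟩
        change Dense ({x | e.1 x = e.2 x}ᶜ)
        rw [← interior_eq_empty_iff_dense_compl, eq_empty_iff_forall_notMem]
        intro x hx
        exact h3 ((hG _ h1).eq_of_eventuallyEq (hG _ h2) (mem_interior_iff_mem_nhds.1 hx))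
    rw [← Finset.closure_biUnion]
    refine eq_univ_of_univ_subset ?_
    rw [← hdense.closure_eq]
    refine closure_mono fun x hx => ?_
    simp only [mem_iInter, mem_ofPred_eq, and_imp, Prod.forall] at hx
    have hmem : x ∈ arrangementCell G ((G ×ˢ G).filter fun e => e.1 x < e.2 x) := by
      intro g hg g' hg' hne
      have := hx g g' hg hg' hne
      simp only [Finset.coe_filter, Finset.mem_product, mem_ofPred_eq, hg, hg', true_and]
      exact ⟨id, fun h => lt_of_le_of_ne (not_lt.1 h) (Ne.symm this)⟩
    simp only [mem_iUnion]
    exact ⟨_, Finset.mem_filter.2 ⟨Finset.mem_image.2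
      ⟨_, Finset.mem_powerset.2 (Finset.filter_subset _ _), rfl⟩, ⟨x, hmem⟩⟩, hmem⟩

/-- The component of `z` in the interior of `{f = g}` is a maximal piece. -/
theorem isMaximalPiece_connectedComponentIn {d : ℕ} {f g : (Fin d → ℝ) → ℝ} (hg : IsAffineFn g)
    {z : Fin d → ℝ} (hz : f =ᶠ[𝓝 z] g) :
    IsMaximalPiece f (connectedComponentIn (interior {x | f x = g x}) z) := by
  have hzi : z ∈ interior {x | f x = g x} := mem_interior_iff_mem_nhds.2 hz
  have hsub := connectedComponentIn_subset (interior {x | f x = g x}) z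
  have hmem := mem_connectedComponentIn hzi
  have hopen : IsOpen (connectedComponentIn (interior {x | f x = g x}) z) :=
    isOpen_interior.connectedComponentIn
  refine ⟨hopen, isConnected_connectedComponentIn_iff.2 hzi,
    ⟨g, hg, fun x hx => ?_⟩, ?_⟩
  · have := interior_subset (hsub hx)
    exact this
  rintro ⟨U, ⟨u, hu⟩, hUc, hUo, hUconn, g', hg', hfg'⟩
  have hgg' : g' = g := by
    refine hg'.eq_of_eventuallyEq hg (x := z) ?_
    filter_upwards [hz, hopen.mem_nhds hmem] with x hx hxP
    rw [← hx, hfg' x (Or.inl hxP)]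
  subst hgg'
  have := hUconn.isPreconnected.subset_connectedComponentIn (Or.inl hmem)
    (interior_maximal (fun x hx => hfg' x hx) hUo)
  exact hUc hu (this (Or.inr hu))

theorem isAffineFn_coord {d : ℕ} (i : Fin d) (a b : ℝ) :
    IsAffineFn fun z : Fin d → ℝ => a * z i + b :=
  ⟨Pi.single i a, b, fun z => by simp [Pi.single_apply]⟩

/-- The upper envelope of a function of the first coordinate and of the tents of height `B` and
slope `K` over `0, …, W - 1` in the remaining coordinates, described by its basic properties. -/
theorem exists_tent_envelope {d : ℕ} (i₀ : Fin d) {h : ℝ → ℝ} (hc : Continuous h) (W : ℕ)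
    (B K : ℝ) :
    ∃ f : (Fin d → ℝ) → ℝ, Continuous f ∧ (∀ z, h (z i₀) ≤ f z) ∧
      (∀ z, ∀ j : {i // i ≠ i₀}, ∀ m : Fin W, B - K * |z j - ((m : ℕ) : ℝ)| ≤ f z) ∧
      ∀ z, f z = h (z i₀) ∨ ∃ j : {i // i ≠ i₀}, ∃ m : Fin W,
        f z = B - K * |z j - ((m : ℕ) : ℝ)| := by
  let F : Option ({i // i ≠ i₀} × Fin W) → (Fin d → ℝ) → ℝ := fun o z =>
    o.elim (h (z i₀)) fun p => B - K * |z p.1 - ((p.2 : ℕ) : ℝ)|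
  refine ⟨fun z => Finset.univ.sup' Finset.univ_nonempty fun o => F o z, ?_, ?_, ?_, ?_⟩
  · refine Continuous.finset_sup'_apply _ fun o _ => ?_
    cases o with
    | none => simp only [F, Option.elim_none]; fun_prop
    | some p => simp only [F, Option.elim_some]; fun_prop
  · exact fun z => Finset.le_sup' (fun o => F o z) (Finset.mem_univ none)
  · exact fun z j m => Finset.le_sup' (fun o => F o z) (Finset.mem_univ (some (j, m)))
  · intro z
    obtain ⟨o, -, ho⟩ := Finset.exists_mem_eq_sup' Finset.univ_nonempty fun o => F o z
    cases o with
    | none => exact Or.inl ho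
    | some p => exact Or.inr ⟨p.1, p.2, ho⟩

/-- The function `h` has a local peak at `t`: it is affine and increasing immediately to the left
of `t`, and smaller than `h t` immediately to the right. -/
def IsPeak (h : ℝ → ℝ) (t : ℝ) : Prop :=
  (∃ F > 0, ∀ᶠ s in 𝓝[<] t, h s = h t + F * (s - t)) ∧ ∀ᶠ s in 𝓝[>] t, h s < h t

/-- From a zigzag function of one variable with `T.card` peaks to a CPA function on `ℝ^d`. -/
theorem exists_cpa_of_peaks {d : ℕ} (hd : 1 ≤ d) {h : ℝ → ℝ} (hc : Continuous h)
    (L : Finset (ℝ × ℝ)) (hL : ∀ t, ∃ e ∈ L, h t = e.1 * t + e.2) (T : Finset ℝ)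
    (hpeak : ∀ t ∈ T, IsPeak h t) (Y : ℝ) (hY : ∀ s, h s ≤ Y) (W : ℕ) :
    ∃ f : (Fin d → ℝ) → ℝ, IsCPA f ∧
      (∃ k ≤ L.card + 2 * ((d - 1) * W), ∃ g : Fin k → (Fin d → ℝ) → ℝ,
        (∀ i, IsAffineFn (g i)) ∧ ∀ x, ∃ i, f x = g i x) ∧
      ∃ Ps : Finset (Set (Fin d → ℝ)), (∀ P ∈ Ps, IsMaximalPiece f P) ∧
        T.card * W ^ (d - 1) ≤ Ps.card := by
  classical
  let i₀ : Fin d := ⟨0, hd⟩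
  have hJ : Fintype.card {i // i ≠ i₀} = d - 1 := by simp
  have hseed : ∀ t ∈ T, ∃ F > 0, ∃ s < t, (∀ᶠ u in 𝓝 s, h u = h t + F * (u - t)) ∧
      ∀ t' ∈ T, t' < t → t' < s := by
    intro t ht
    obtain ⟨F, hF, hev⟩ := (hpeak t ht).1
    have h1 := eventually_eventually_nhdsWithin.2 hev
    have h2 : ∀ᶠ s in 𝓝[<] t, ∀ t' ∈ T, t' < t → t' < s := by
      rw [Filter.eventually_all_finset]
      intro t' _
      by_cases h : t' < t
      · filter_upwards [Ioo_mem_nhdsLT h] with s hs _ using hs.1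
      · exact Eventually.of_forall fun s h' => absurd h' h
    obtain ⟨s, ⟨hs1, hs2⟩, hs3⟩ := ((h1.and h2).and self_mem_nhdsWithin).exists
    refine ⟨F, hF, s, hs3, ?_, hs2⟩
    rwa [isOpen_Iio.nhdsWithin_eq hs3] at hs1
  choose! F hF s hst hs hsT using hseed
  obtain ⟨A, hA⟩ : ∃ A, ∀ t ∈ T, A ≤ h (s t) := by
    obtain ⟨A, hA⟩ := (T.image fun t => h (s t)).bddBelow
    exact ⟨A, fun t ht => hA (by simpa using ⟨t, ht, rfl⟩)⟩
  let B := Y + 1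
  let K := 2 * (|B - A| + 1)
  have hK : 0 < K := by positivity
  have hBK : B - K * (1 / 2) < A := by
    have := le_abs_self (B - A)
    simp only [K]; linarith
  obtain ⟨f, hfc, hfh, hfw, hf⟩ := exists_tent_envelope i₀ hc W B K
  let G : Finset ((Fin d → ℝ) → ℝ) :=
    L.image (fun e z => e.1 * z i₀ + e.2) ∪
      (Finset.univ : Finset (Bool × {i // i ≠ i₀} × Fin W)).image fun q z =>
        (if q.1 then K else -K) * z q.2.1 + (B - (if q.1 then K else -K) * (q.2.2 : ℕ))
  have hG : ∀ g ∈ G, IsAffineFn g := by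
    intro g hg
    rcases Finset.mem_union.1 hg with hg | hg
    · obtain ⟨e, -, rfl⟩ := Finset.mem_image.1 hg
      exact isAffineFn_coord _ _ _
    · obtain ⟨e, -, rfl⟩ := Finset.mem_image.1 hg
      exact isAffineFn_coord _ _ _
  have hGf : ∀ x, ∃ g ∈ G, f x = g x := by
    intro x
    rcases hf x with hx | ⟨j, m, hx⟩
    · obtain ⟨e, he, hx'⟩ := hL (x i₀)
      exact ⟨_, Finset.mem_union_left _ (Finset.mem_image_of_mem _ he), hx.trans hx'⟩
    · refine ⟨_, Finset.mem_union_right _ (Finset.mem_image_of_mem _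
        (Finset.mem_univ (decide (x j - ((m : ℕ) : ℝ) < 0), j, m))), hx.trans ?_⟩
      by_cases h0 : x j - (m : ℕ) < 0
      · simp only [h0, abs_of_neg h0, decide_true, if_true]; ring
      · simp only [h0, abs_of_nonneg (not_lt.1 h0), decide_false]; simp; ring
  have hGcard : G.card ≤ L.card + 2 * ((d - 1) * W) := by
    refine (Finset.card_union_le _ _).trans (add_le_add Finset.card_image_le ?_)
    refine Finset.card_image_le.trans ?_
    rw [Finset.card_univ, Fintype.card_prod, Fintype.card_prod, hJ, Fintype.card_bool,
      Fintype.card_fin]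
  refine ⟨f, isCPA_of_finset hfc G hG hGf, ⟨G.card, hGcard, fun i => G.equivFin.symm i,
    fun i => hG _ (G.equivFin.symm i).2, fun x => ?_⟩, ?_⟩
  · obtain ⟨g, hg, hx⟩ := hGf x
    exact ⟨G.equivFin ⟨g, hg⟩, by simpa using hx⟩
  let ℓ : ℝ → (Fin d → ℝ) → ℝ := fun t z => F t * z i₀ + (h t - F t * t)
  have hℓ : ∀ t, IsAffineFn (ℓ t) := fun t => isAffineFn_coord _ _ _
  let seed : ℝ → ({i // i ≠ i₀} → Fin W) → Fin d → ℝ := fun t m i =>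
    if hi : i = i₀ then s t else (m ⟨i, hi⟩ : ℕ) - 1 / 2
  have seed₀ : ∀ t m, seed t m i₀ = s t := fun t m => by simp [seed]
  have seed₁ : ∀ t m, ∀ j : {i // i ≠ i₀}, seed t m j = (m j : ℕ) - 1 / 2 := fun t m j => by
    simp [seed, j.2]
  have hnear : ∀ t ∈ T, ∀ m, f =ᶠ[𝓝 (seed t m)] ℓ t := by
    intro t ht m
    have hi : Tendsto (fun z : Fin d → ℝ => z i₀) (𝓝 (seed t m)) (𝓝 (s t)) := by
      have := (continuous_apply i₀).tendsto (seed t m)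
      rwa [seed₀] at this
    have h1 := hi.eventually (hs t ht)
    have h2 : ∀ᶠ z in 𝓝 (seed t m), ∀ j : {i // i ≠ i₀}, ∀ m' : Fin W,
        B - K * |z j - ((m' : ℕ) : ℝ)| < h (z i₀) := by
      rw [Filter.eventually_all]; intro j
      rw [Filter.eventually_all]; intro m'
      refine Tendsto.eventually_lt (f := fun z : Fin d → ℝ => B - K * |z j - ((m' : ℕ) : ℝ)|)
        (g := fun z : Fin d → ℝ => h (z i₀)) (Continuous.tendsto (by fun_prop) _)
        (Continuous.tendsto (by fun_prop) _) ?_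
      rw [seed₀, seed₁]
      refine lt_of_lt_of_le ?_ (hA t ht)
      refine lt_of_le_of_lt ?_ hBK
      have : (1 / 2 : ℝ) ≤ |((m j : ℕ) : ℝ) - 1 / 2 - (m' : ℕ)| := by
        rcases le_or_gt (m j : ℕ) (m' : ℕ) with hle | hlt
        · have : ((m j : ℕ) : ℝ) ≤ (m' : ℕ) := by exact_mod_cast hle
          rw [le_abs]; right; linarith
        · have : ((m' : ℕ) : ℝ) + 1 ≤ (m j : ℕ) := by exact_mod_cast hlt
          rw [le_abs]; left; linarith
      have := mul_le_mul_of_nonneg_left this hK.le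
      linarith
    filter_upwards [h1, h2] with z hz1 hz2
    rcases hf z with hz | ⟨j, m', hz⟩
    · rw [hz, hz1]; simp only [ℓ]; ring
    · exact absurd (hfh z) (not_le.2 (hz ▸ hz2 j m'))
  let P : ℝ × ({i // i ≠ i₀} → Fin W) → Set (Fin d → ℝ) := fun p =>
    connectedComponentIn (interior {x | f x = ℓ p.1 x}) (seed p.1 p.2)
  have hPmem : ∀ p, p.1 ∈ T → seed p.1 p.2 ∈ P p := fun p hp =>
    mem_connectedComponentIn (mem_interior_iff_mem_nhds.2 (hnear p.1 hp p.2))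
  have hPf : ∀ p, ∀ w ∈ P p, f w = ℓ p.1 w := fun p w hw => by
    have := interior_subset (connectedComponentIn_subset _ _ hw)
    exact this
  have hPh : ∀ p, p.1 ∈ T → ∀ w ∈ P p, f w = h (w i₀) := by
    intro p hp w hw
    rcases hf w with hw' | ⟨j, m, hw'⟩
    · exact hw'
    exfalso
    have hopen : IsOpen (P p) := isOpen_interior.connectedComponentIn
    have hcont : Continuous fun ε : ℝ => Function.update w i₀ (w i₀ - ε) := by fun_prop
    have hev : ∀ᶠ ε in 𝓝[>] (0 : ℝ), Function.update w i₀ (w i₀ - ε) ∈ P p := by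
      refine nhdsWithin_le_nhds (hcont.tendsto 0 (hopen.mem_nhds ?_))
      simpa using hw
    obtain ⟨ε, hε, hε0⟩ := (hev.and self_mem_nhdsWithin).exists
    have e1 := hPf p _ hε
    have e2 := hPf p _ hw
    have e3 := hfw (Function.update w i₀ (w i₀ - ε)) j m
    rw [Function.update_of_ne j.2, ← hw', e1, e2] at e3
    simp only [ℓ, Function.update_self] at e3
    have := mul_pos (hF p.1 hp) (show 0 < ε from hε0)
    nlinarith
  have hcross : ∀ p p', p.1 ∈ T → p'.1 ∈ T → P p = P p' → ∀ i, ∀ r,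
      seed p.1 p.2 i ≤ r → r ≤ seed p'.1 p'.2 i → ∃ w ∈ P p, w i = r := by
    intro p p' hp hp' hPP i r h1 h2
    have hpre : IsPreconnected (Set.image (fun w : Fin d → ℝ => w i) (P p)) :=
      isPreconnected_connectedComponentIn.image _ (continuous_apply i).continuousOn
    have := hpre.Icc_subset (mem_image_of_mem _ (hPmem p hp))
      (mem_image_of_mem _ (hPP ▸ hPmem p' hp')) ⟨h1, h2⟩
    exact this
  have hne₀ : ∀ p p', p.1 ∈ T → p'.1 ∈ T → P p = P p' → ¬ p.1 < p'.1 := by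
    intro p p' hp hp' hPP hlt
    obtain ⟨r, hr, hr1, hr2⟩ := ((hpeak p.1 hp).2.and
      (Ioo_mem_nhdsGT (hsT p'.1 hp' p.1 hp hlt))).exists
    obtain ⟨w, hw, rfl⟩ := hcross p p' hp hp' hPP i₀ r
      (by rw [seed₀]; exact ((hst p.1 hp).trans hr1).le) (by rw [seed₀]; exact hr2.le)
    have e1 := hPf p w hw
    rw [hPh p hp w hw] at e1
    simp only [ℓ] at e1
    have := mul_pos (hF p.1 hp) (sub_pos.2 hr1)
    nlinarith
  have hne₁ : ∀ p p', p.1 ∈ T → p'.1 ∈ T → P p = P p' → ∀ j, ¬ p.2 j < p'.2 j := by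
    intro p p' hp hp' hPP j hlt
    have hlt : ((p.2 j : ℕ) : ℝ) + 1 ≤ (p'.2 j : ℕ) := by exact_mod_cast hlt
    obtain ⟨w, hw, hwj⟩ := hcross p p' hp hp' hPP j (p.2 j : ℕ)
      (by rw [seed₁]; linarith) (by rw [seed₁]; linarith)
    have e1 := hfw w j (p.2 j)
    rw [hwj, hPh p hp w hw] at e1
    have := hY (w i₀)
    simp only [sub_self, abs_zero, mul_zero, sub_zero, B] at e1
    linarith
  refine ⟨(T ×ˢ Finset.univ).image P, ?_, ?_⟩
  · intro Q hQ
    obtain ⟨p, hp, rfl⟩ := Finset.mem_image.1 hQ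
    exact isMaximalPiece_connectedComponentIn (hℓ _)
      (hnear _ (Finset.mem_product.1 hp).1 _)
  · rw [Finset.card_image_of_injOn, Finset.card_product, Finset.card_univ, Fintype.card_fun, hJ,
      Fintype.card_fin]
    intro p hp p' hp' hPP
    have hp := (Finset.mem_product.1 hp).1
    have hp' := (Finset.mem_product.1 hp').1
    refine Prod.ext ?_ (funext fun j => ?_)
    · exact le_antisymm (not_lt.1 (hne₀ p' p hp' hp hPP.symm)) (not_lt.1 (hne₀ p p' hp hp' hPP))
    · exact le_antisymm (not_lt.1 (hne₁ p' p hp' hp hPP.symm j))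
        (not_lt.1 (hne₁ p p' hp hp' hPP j))

theorem IsPeak.congr {h h' : ℝ → ℝ} {t : ℝ} (ht : IsPeak h t) (hh : h' =ᶠ[𝓝 t] h) :
    IsPeak h' t := by
  obtain ⟨⟨F, hF, hl⟩, hr⟩ := ht
  refine ⟨⟨F, hF, ?_⟩, ?_⟩
  · filter_upwards [hl, nhdsWithin_le_nhds hh] with s h1 h2
    rw [h2, h1, hh.self_of_nhds]
  · filter_upwards [hr, nhdsWithin_le_nhds hh] with s h1 h2
    rwa [h2, hh.self_of_nhds]

/-- Points whose consecutive pairs are joined by a down-line followed by an up-line from `G` are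
the peaks of a zigzag function built from the lines of `G` and two further lines. -/
theorem exists_zigzag {ι : Type*} [DecidableEq ι] (x y : ι → ℝ) (G : Finset (ℝ × ℝ))
    (X : Finset ι) (hX : X.Nonempty) (hinj : ∀ p ∈ X, ∀ q ∈ X, x p = x q → p = q)
    (hcons : ∀ p ∈ X, ∀ p' ∈ X, x p < x p' → (∀ q ∈ X, ¬ (x p < x q ∧ x q < x p')) →
      ∃ u v, u < 0 ∧ 0 < v ∧ (u, y p - u * x p) ∈ G ∧ (v, y p' - v * x p') ∈ G ∧
        y p + u * (x p' - x p) < y p' ∧ y p' - v * (x p' - x p) < y p) :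
    ∃ e₁ : ℝ × ℝ, ∃ m ∈ X, (∀ p ∈ X, x p ≤ x m) ∧ ∃ h : ℝ → ℝ, Continuous h ∧
      (∀ t ≤ x m, ∃ e ∈ insert e₁ G, h t = e.1 * t + e.2) ∧
      (∀ t, x m ≤ t → h t = y m - (t - x m)) ∧
      (∀ p ∈ X, IsPeak h (x p)) ∧ ∃ Y, ∀ t, h t ≤ Y := by
  induction X using Finset.induction_on_max_value x with
  | empty => exact absurd hX (by simp)
  | insert a X haX hmax ih =>
    rcases X.eq_empty_or_nonempty with rfl | hXne
    · refine ⟨(1, y a - x a), a, by simp, by simp, fun t => y a - |t - x a|, by fun_prop, ?_, ?_,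
        ?_, y a, fun t => by linarith [abs_nonneg (t - x a)]⟩
      · intro t ht
        refine ⟨_, Finset.mem_insert_self _ _, ?_⟩
        dsimp only
        rw [abs_of_nonpos (by linarith)]; ring
      · intro t ht
        dsimp only
        rw [abs_of_nonneg (by linarith)]
      · intro p hp
        obtain rfl : p = a := by simpa using hp
        refine ⟨⟨1, one_pos, ?_⟩, ?_⟩
        · filter_upwards [self_mem_nhdsWithin] with s hs
          have hs : s < x p := hs
          rw [abs_of_neg (by linarith)]; simp; ring
        · filter_upwards [self_mem_nhdsWithin] with s hs
          have hs : x p < s := hs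
          rw [abs_of_pos (by linarith)]; simp [hs]
    · obtain ⟨e₁, m, hm, hmm, h, hc, hcov, htail, hpk, Y, hY⟩ := ih hXne
        (fun p hp q hq => hinj p (Finset.mem_insert_of_mem hp) q (Finset.mem_insert_of_mem hq))
        (fun p hp p' hp' hlt hno => hcons p (Finset.mem_insert_of_mem hp) p'
          (Finset.mem_insert_of_mem hp') hlt fun q hq => by
            rcases Finset.mem_insert.1 hq with rfl | hq
            · exact fun h => absurd h.2 (not_lt.2 (hmax _ hp'))
            · exact hno q hq)
      have hma : x m < x a := lt_of_le_of_ne (hmax m hm) fun he => haX <|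
        hinj m (Finset.mem_insert_of_mem hm) a (Finset.mem_insert_self _ _) he ▸ hm
      obtain ⟨u, v, hu, hv, huG, hvG, h1, h2⟩ := hcons m (Finset.mem_insert_of_mem hm) a
        (Finset.mem_insert_self _ _) hma fun q hq => by
          rcases Finset.mem_insert.1 hq with rfl | hq
          · exact fun h => lt_irrefl _ h.2
          · exact fun h => absurd h.1 (not_lt.2 (hmm q hq))
      have hhm : h (x m) = y m := by rw [htail _ le_rfl]; ring
      let D : ℝ → ℝ := fun t => y m + u * (t - x m)
      let U : ℝ → ℝ := fun t => y a + v * (t - x a)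
      have hDc : Continuous D := by fun_prop
      have hUc : Continuous U := by fun_prop
      have hDm : D (x m) = y m := by simp [D]
      have hUa : U (x a) = y a := by simp [U]
      have hUm : U (x m) < y m := by simp only [U]; linarith
      have hDa : D (x a) < y a := h1
      let h' : ℝ → ℝ := fun t =>
        if t ≤ x m then h t else if t ≤ x a then max (D t) (U t) else y a - (t - x a)
      have hlow : ∀ t ≤ x m, h' t = h t := fun t ht => if_pos ht
      have hmid : ∀ t, x m < t → t ≤ x a → h' t = max (D t) (U t) := fun t ht ht' => by
        simp only [h', if_neg (not_le.2 ht), if_pos ht']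
      have hhigh : ∀ t, x a ≤ t → h' t = y a - (t - x a) := fun t ht => by
        rcases ht.eq_or_lt with rfl | ht
        · rw [hmid _ hma le_rfl, hUa, max_eq_right hDa.le]; ring
        · simp only [h', if_neg (not_le.2 (hma.trans ht)), if_neg (not_le.2 ht)]
      refine ⟨e₁, a, Finset.mem_insert_self _ _, ?_, h', ?_, ?_, hhigh, ?_,
        max Y (max (y m) (y a)), ?_⟩
      · intro p hp
        rcases Finset.mem_insert.1 hp with rfl | hp
        · exact le_rfl
        · exact hmax p hp
      · refine Continuous.if_le hc (Continuous.if_le (hDc.max hUc) (by fun_prop) continuous_id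
          continuous_const ?_) continuous_id continuous_const ?_
        · rintro t rfl
          rw [hUa, max_eq_right hDa.le]; ring
        · rintro t rfl
          rw [if_pos hma.le, hhm, hDm, max_eq_left hUm.le]
      · intro t ht
        rcases le_or_gt t (x m) with htm | htm
        · rw [hlow t htm]; exact hcov t htm
        · rw [hmid t htm ht]
          rcases max_choice (D t) (U t) with he | he
          · exact ⟨_, Finset.mem_insert_of_mem huG, by rw [he]; simp only [D]; ring⟩
          · exact ⟨_, Finset.mem_insert_of_mem hvG, by rw [he]; simp only [U]; ring⟩
      · intro p hp
        rcases Finset.mem_insert.1 hp with rfl | hp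
        · refine ⟨⟨v, hv, ?_⟩, ?_⟩
          · have hev : ∀ᶠ t in 𝓝 (x p), D t < U t :=
              (hDc.tendsto _).eventually_lt (hUc.tendsto _) (by rw [hUa]; exact hDa)
            filter_upwards [nhdsWithin_le_nhds hev, Ioo_mem_nhdsLT hma] with t ht1 ht2
            rw [hmid t ht2.1 ht2.2.le, max_eq_right ht1.le, hhigh _ le_rfl]
            simp only [U]; ring
          · filter_upwards [self_mem_nhdsWithin] with t ht
            have ht : x p < t := ht
            rw [hhigh t ht.le, hhigh _ le_rfl]; linarith
        · rcases (hmm p hp).eq_or_lt with he | hlt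
          · have hpm := hpk p hp
            rw [he] at hpm ⊢
            refine ⟨?_, ?_⟩
            · obtain ⟨F, hF, hl⟩ := hpm.1
              refine ⟨F, hF, ?_⟩
              filter_upwards [hl, self_mem_nhdsWithin] with t ht ht'
              rw [hlow t (le_of_lt ht'), hlow _ le_rfl, ht]
            · have hev : ∀ᶠ t in 𝓝 (x m), U t < y m :=
                (hUc.tendsto _).eventually_lt tendsto_const_nhds hUm
              filter_upwards [nhdsWithin_le_nhds hev, Ioo_mem_nhdsGT hma] with t ht1 ht2
              rw [hmid t ht2.1 ht2.2.le, hlow _ le_rfl, hhm]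
              refine max_lt ?_ ht1
              have := mul_neg_of_neg_of_pos hu (sub_pos.2 ht2.1)
              simp only [D]; linarith
          · refine (hpk p hp).congr ?_
            filter_upwards [Iio_mem_nhds hlt] with t ht
            exact hlow t (le_of_lt ht)
      · intro t
        rcases le_or_gt t (x m) with htm | htm
        · rw [hlow t htm]; exact (hY t).trans (le_max_left _ _)
        · refine le_trans ?_ (le_max_right _ _)
          rcases le_or_gt t (x a) with hta | hta
          · rw [hmid t htm hta]
            refine max_le_max ?_ ?_
            · have := mul_neg_of_neg_of_pos hu (sub_pos.2 htm)
              simp only [D]; linarith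
            · have := mul_nonneg hv.le (sub_nonneg.2 hta)
              simp only [U]; linarith
          · rw [hhigh t hta.le]
            exact le_trans (by linarith) (le_max_right _ _)

open scoped goldenRatio

/-- The linear form on `ℤ × ℤ` whose kernel is spanned by `(-F (k + 1), F k)`, with `F` the
Fibonacci sequence. -/
def fibForm (k : ℕ) (p : ℤ × ℤ) : ℤ := p.1 * Nat.fib k + p.2 * Nat.fib (k + 1)

/-- The abscissa `a + b φ` of the lattice point `(a, b)`. -/
noncomputable def goldenCoord (p : ℤ × ℤ) : ℝ := p.1 + p.2 * φ

theorem fibForm_add (k : ℕ) (p q : ℤ × ℤ) : fibForm k (p + q) = fibForm k p + fibForm k q := by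
  simp only [fibForm, Prod.fst_add, Prod.snd_add]; ring

theorem fibForm_sub (k : ℕ) (p q : ℤ × ℤ) : fibForm k (p - q) = fibForm k p - fibForm k q := by
  simp only [fibForm, Prod.fst_sub, Prod.snd_sub]; ring

theorem fibForm_smul (k : ℕ) (E : ℤ) (p : ℤ × ℤ) : fibForm k (E • p) = E * fibForm k p := by
  simp only [fibForm, Prod.smul_fst, Prod.smul_snd, smul_eq_mul]; ring

theorem goldenCoord_add (p q : ℤ × ℤ) : goldenCoord (p + q) = goldenCoord p + goldenCoord q := by
  simp only [goldenCoord, Prod.fst_add, Prod.snd_add]; push_cast; ring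

theorem goldenCoord_sub (p q : ℤ × ℤ) : goldenCoord (p - q) = goldenCoord p - goldenCoord q := by
  simp only [goldenCoord, Prod.fst_sub, Prod.snd_sub]; push_cast; ring

theorem goldenCoord_injective : Function.Injective goldenCoord := by
  intro p q h
  rw [← sub_eq_zero, ← goldenCoord_sub] at h
  have hb : (p - q).2 = 0 := by
    by_contra hb
    have hirr := (Real.goldenRatio_irrational.intCast_mul hb).intCast_add (p - q).1
    exact hirr.ne_zero h
  have ha : (p - q).1 = 0 := by
    simp only [goldenCoord, hb, Int.cast_zero, zero_mul, add_zero] at h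
    exact_mod_cast h
  exact sub_eq_zero.1 (Prod.ext ha hb)

theorem fib_cassini_of_even {k : ℕ} (hk : Even k) :
    (Nat.fib (k + 1) : ℤ) ^ 2 - Nat.fib k * Nat.fib (k + 2) = 1 := by
  obtain ⟨m, rfl⟩ := hk
  induction m with
  | zero => simp
  | succ m ih =>
    rw [show m + 1 + (m + 1) = m + m + 2 by ring]
    have h2 : Nat.fib (m + m + 2) = Nat.fib (m + m) + Nat.fib (m + m + 1) := Nat.fib_add_two
    have h3 : Nat.fib (m + m + 2 + 1) = Nat.fib (m + m + 1) + Nat.fib (m + m + 2) :=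
      Nat.fib_add_two
    have h4 : Nat.fib (m + m + 2 + 2) = Nat.fib (m + m + 2) + Nat.fib (m + m + 2 + 1) :=
      Nat.fib_add_two
    rw [h4, h3, h2]
    rw [h2] at ih
    push_cast at ih ⊢
    linear_combination ih

theorem snd_eq_fibForm {k : ℕ} (hk : Even k) (p : ℤ × ℤ) :
    p.2 = fibForm k p * Nat.fib (k + 1) - fibForm (k + 1) p * Nat.fib k := by
  simp only [fibForm]
  linear_combination (-p.2) * fib_cassini_of_even hk

theorem goldenCoord_eq_fibForm {k : ℕ} (hk : Even k) (p : ℤ × ℤ) :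
    goldenCoord p = fibForm (k + 1) p * ψ ^ k + fibForm k p * -ψ ^ (k + 1) := by
  have h1 := Real.fib_succ_sub_goldenConj_mul_fib k
  have h2 := Real.fib_succ_sub_goldenConj_mul_fib (k + 1)
  have h3 : φ ^ k * ψ ^ k = 1 := by
    rw [← mul_pow, Real.goldenRatio_mul_goldenConj, hk.neg_one_pow]
  simp only [goldenCoord, fibForm]
  push_cast
  rw [pow_succ] at h2 ⊢
  generalize φ = x at *
  generalize ψ = z at *
  linear_combination (-(p.1 : ℝ) * z ^ k) * h1 - (p.2 : ℝ) * z ^ k * h2 -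
    ((p.1 : ℝ) + p.2 * x) * h3

theorem goldenCoord_pos_of_fibForm_pos {k : ℕ} (hk : Even k) {p : ℤ × ℤ} (h₀ : 0 < fibForm k p)
    (h₁ : 0 < fibForm (k + 1) p) : 0 < goldenCoord p := by
  rw [goldenCoord_eq_fibForm hk]
  have h₀ : (0 : ℝ) < fibForm k p := by exact_mod_cast h₀
  have h₁ : (0 : ℝ) < fibForm (k + 1) p := by exact_mod_cast h₁
  have e₀ : 0 < ψ ^ k := hk.pow_pos Real.goldenConj_ne_zero
  have e₁ : 0 < -ψ ^ (k + 1) := neg_pos.2 (hk.add_one.pow_neg Real.goldenConj_neg)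
  positivity

/-- Lattice points of positive abscissa and small height lie in the cone where two consecutive
Fibonacci forms are positive. -/
theorem fibForm_pos_of_goldenCoord_pos {k : ℕ} (hk : Even k) {p : ℤ × ℤ}
    (hb : |p.2| < Nat.fib k) (hp : 0 < goldenCoord p) :
    0 < fibForm k p ∧ 0 < fibForm (k + 1) p := by
  rw [goldenCoord_eq_fibForm hk] at hp
  have hsnd := snd_eq_fibForm hk p
  have e₀ : 0 < ψ ^ k := hk.pow_pos Real.goldenConj_ne_zero
  have e₁ : 0 < -ψ ^ (k + 1) := neg_pos.2 (hk.add_one.pow_neg Real.goldenConj_neg)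
  have hF : (Nat.fib k : ℤ) ≤ Nat.fib (k + 1) := by exact_mod_cast Nat.fib_le_fib_succ
  have hF0 : (0 : ℤ) ≤ Nat.fib k := by positivity
  obtain ⟨hb1, hb2⟩ := abs_lt.1 hb
  generalize fibForm k p = β at *
  generalize fibForm (k + 1) p = α at *
  constructor
  · by_contra! hβ
    have hβ' : (β : ℝ) ≤ 0 := by exact_mod_cast hβ
    have hα : 0 < α := by
      by_contra! hα
      have hα' : (α : ℝ) ≤ 0 := by exact_mod_cast hα
      linarith [mul_nonpos_of_nonpos_of_nonneg hα' e₀.le,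
        mul_nonpos_of_nonpos_of_nonneg hβ' e₁.le]
    nlinarith [mul_le_mul_of_nonneg_right hα hF0,
      mul_nonpos_of_nonpos_of_nonneg hβ (hF0.trans hF)]
  · by_contra! hα
    have hα' : (α : ℝ) ≤ 0 := by exact_mod_cast hα
    have hβ : 0 < β := by
      by_contra! hβ
      have hβ' : (β : ℝ) ≤ 0 := by exact_mod_cast hβ
      linarith [mul_nonpos_of_nonpos_of_nonneg hα' e₀.le,
        mul_nonpos_of_nonpos_of_nonneg hβ' e₁.le]
    nlinarith [mul_le_mul_of_nonneg_right hβ (hF0.trans hF),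
      mul_nonpos_of_nonpos_of_nonneg hα hF0]

/-- The line of slope `-F k / ψ ^ k` formed by the points `(goldenCoord p, p.2)` with
`fibForm k p = c`, as a pair (slope, intercept). -/
noncomputable def fibLine (e : ℕ × ℤ) : ℝ × ℝ := (-Nat.fib e.1 / ψ ^ e.1, e.2 / ψ ^ e.1)

theorem fibLine_fibForm (k : ℕ) (p : ℤ × ℤ) : fibLine (k, fibForm k p) =
    ((fibLine (k, fibForm k p)).1, p.2 - (fibLine (k, fibForm k p)).1 * goldenCoord p) := by
  refine Prod.ext rfl ?_
  have h := Real.fib_succ_sub_goldenRatio_mul_fib k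
  have h0 : ψ ^ k ≠ 0 := pow_ne_zero _ Real.goldenConj_ne_zero
  simp only [fibLine, fibForm, goldenCoord]
  push_cast
  generalize φ = x at *
  generalize ψ ^ k = z at *
  field_simp
  linear_combination (p.2 : ℝ) * h

/-- The combinatorial condition on lines making `X` the set of peaks of a zigzag: any two
consecutive points are joined by a down-line and an up-line from `𝓛` in consecutive directions. -/
def FibLinked (X : Finset (ℤ × ℤ)) (𝓛 : Finset (ℕ × ℤ)) : Prop :=
  ∀ p ∈ X, ∀ p' ∈ X, goldenCoord p < goldenCoord p' →
    (∀ q ∈ X, ¬ (goldenCoord p < goldenCoord q ∧ goldenCoord q < goldenCoord p')) →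
    ∃ k, Even k ∧ 0 < k ∧ (k, fibForm k p) ∈ 𝓛 ∧ (k + 1, fibForm (k + 1) p') ∈ 𝓛 ∧
      0 < fibForm k (p' - p) ∧ 0 < fibForm (k + 1) (p' - p)

theorem FibLinked.exists_lines {X : Finset (ℤ × ℤ)} {𝓛 : Finset (ℕ × ℤ)} (h : FibLinked X 𝓛) :
    ∀ p ∈ X, ∀ p' ∈ X, goldenCoord p < goldenCoord p' →
      (∀ q ∈ X, ¬ (goldenCoord p < goldenCoord q ∧ goldenCoord q < goldenCoord p')) →
      ∃ u v : ℝ, u < 0 ∧ 0 < v ∧ (u, (p.2 : ℝ) - u * goldenCoord p) ∈ 𝓛.image fibLine ∧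
        (v, (p'.2 : ℝ) - v * goldenCoord p') ∈ 𝓛.image fibLine ∧
        (p.2 : ℝ) + u * (goldenCoord p' - goldenCoord p) < p'.2 ∧
        (p'.2 : ℝ) - v * (goldenCoord p' - goldenCoord p) < p.2 := by
  intro p hp p' hp' hlt hno
  obtain ⟨k, hk, hk0, h₁, h₂, c₁, c₂⟩ := h p hp p' hp' hlt hno
  have e₀ : 0 < ψ ^ k := hk.pow_pos Real.goldenConj_ne_zero
  have e₁ : ψ ^ (k + 1) < 0 := hk.add_one.pow_neg Real.goldenConj_neg
  have hF : (0 : ℝ) < Nat.fib k := by exact_mod_cast Nat.fib_pos.2 hk0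
  have hF' : (0 : ℝ) < Nat.fib (k + 1) := by exact_mod_cast Nat.fib_pos.2 k.succ_pos
  refine ⟨(fibLine (k, fibForm k p)).1, (fibLine (k + 1, fibForm (k + 1) p')).1, ?_, ?_, ?_, ?_,
    ?_, ?_⟩
  · exact div_neg_of_neg_of_pos (neg_lt_zero.2 hF) e₀
  · exact div_pos_of_neg_of_neg (neg_lt_zero.2 hF') e₁
  · rw [← fibLine_fibForm]; exact Finset.mem_image_of_mem _ h₁
  · rw [← fibLine_fibForm]; exact Finset.mem_image_of_mem _ h₂
  · have i := congrArg Prod.snd (fibLine_fibForm k p)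
    have i' := congrArg Prod.snd (fibLine_fibForm k p')
    simp only [fibLine] at i i' ⊢
    have c : (fibForm k p : ℝ) < fibForm k p' := by
      rw [fibForm_sub] at c₁; exact_mod_cast sub_pos.1 c₁
    have := div_lt_div_of_pos_right c e₀
    linarith
  · have i := congrArg Prod.snd (fibLine_fibForm (k + 1) p)
    have i' := congrArg Prod.snd (fibLine_fibForm (k + 1) p')
    simp only [fibLine] at i i' ⊢
    have c : (fibForm (k + 1) p : ℝ) < fibForm (k + 1) p' := by
      rw [fibForm_sub] at c₂; exact_mod_cast sub_pos.1 c₂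
    have := div_lt_div_of_neg_of_lt e₁ c
    linarith

theorem sum_biUnion_le_sum {α β : Type*} [DecidableEq α] [DecidableEq β] (s : Finset α)
    (t : α → Finset β) (f : β → ℕ) :
    ∑ x ∈ s.biUnion t, f x ≤ ∑ a ∈ s, ∑ x ∈ t a, f x := by
  induction s using Finset.induction_on with
  | empty => simp
  | insert a s ha ih =>
    rw [Finset.biUnion_insert, Finset.sum_insert ha]
    have := Finset.sum_union_inter (s₁ := t a) (s₂ := s.biUnion t) (f := f)
    omega

/-- The square grid `[0, N) × [0, N)` in `ℤ × ℤ`. -/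
noncomputable def intGrid (N : ℕ) : Finset (ℤ × ℤ) := Finset.Ico 0 (N : ℤ) ×ˢ Finset.Ico 0 (N : ℤ)

theorem card_intGrid (N : ℕ) : (intGrid N).card = N ^ 2 := by
  simp [intGrid, sq]

theorem abs_sub_snd_lt_of_mem_intGrid {N : ℕ} {q q' : ℤ × ℤ} (hq : q ∈ intGrid N)
    (hq' : q' ∈ intGrid N) : |(q' - q).2| < N := by
  simp only [intGrid, Finset.mem_product, Finset.mem_Ico] at hq hq'
  rw [abs_lt, Prod.snd_sub]
  omega

theorem card_image_fibForm_intGrid (k N : ℕ) :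
    ((intGrid N).image (fibForm k)).card ≤ N * Nat.fib (k + 2) := by
  have hsub : (intGrid N).image (fibForm k) ⊆ Finset.Ico 0 ((N * Nat.fib (k + 2) : ℕ) : ℤ) := by
    intro v hv
    obtain ⟨q, hq, rfl⟩ := Finset.mem_image.1 hv
    simp only [intGrid, Finset.mem_product, Finset.mem_Ico] at hq
    obtain ⟨⟨h1, h2⟩, h3, h4⟩ := hq
    have e : (Nat.fib (k + 2) : ℤ) = Nat.fib k + Nat.fib (k + 1) := by
      exact_mod_cast Nat.fib_add_two
    have f0 : (0 : ℤ) ≤ Nat.fib k := by positivity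
    have f1 : (0 : ℤ) < Nat.fib (k + 1) := by exact_mod_cast Nat.fib_pos.2 k.succ_pos
    rw [Finset.mem_Ico]
    push_cast
    rw [e]
    simp only [fibForm]
    constructor
    · positivity
    · nlinarith [mul_le_mul_of_nonneg_right h2.le f0, mul_lt_mul_of_pos_right h4 f1]
  have := Finset.card_le_card hsub
  rwa [Int.card_Ico, sub_zero, Int.toNat_natCast] at this

theorem fibForm_pos_of_mem_intGrid {k : ℕ} (hk : Even k) {q q' : ℤ × ℤ}
    (hq : q ∈ intGrid (Nat.fib k)) (hq' : q' ∈ intGrid (Nat.fib k))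
    (hlt : goldenCoord q < goldenCoord q') :
    0 < fibForm k (q' - q) ∧ 0 < fibForm (k + 1) (q' - q) :=
  fibForm_pos_of_goldenCoord_pos hk (abs_sub_snd_lt_of_mem_intGrid hq hq')
    (by rw [goldenCoord_sub]; exact sub_pos.2 hlt)

/-- Replacing every point of a sufficiently dilated grid by a copy of `X` preserves the linking
condition; the lines needed are translates of the old ones and the lines of the new grid. -/
theorem exists_fibLinked_step {X : Finset (ℤ × ℤ)} {𝓛 : Finset (ℕ × ℤ)} (hX : X.Nonempty)
    (h : FibLinked X 𝓛) {k : ℕ} (hk : Even k) (hk0 : 0 < k) :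
    ∃ X' : Finset (ℤ × ℤ), ∃ 𝓛' : Finset (ℕ × ℤ), X'.Nonempty ∧
      X'.card = Nat.fib k ^ 2 * X.card ∧ FibLinked X' 𝓛' ∧
      ∀ M : ℕ → ℕ, ∑ e ∈ 𝓛', M e.1 ≤
        ∑ e ∈ 𝓛, M e.1 * (Nat.fib k * Nat.fib (e.1 + 2)) +
          Nat.fib k ^ 2 * (M k + M (k + 1)) := by
  classical
  have hN : 0 < Nat.fib k := Nat.fib_pos.2 hk0
  obtain ⟨E, hE0, hE⟩ : ∃ E : ℤ, 0 < E ∧ ∀ p ∈ X, ∀ p' ∈ X,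
      -E < fibForm k (p' - p) ∧ -E < fibForm (k + 1) (p' - p) := by
    refine ⟨1 + ∑ e ∈ X ×ˢ X, (|fibForm k (e.2 - e.1)| + |fibForm (k + 1) (e.2 - e.1)|), ?_, ?_⟩
    · have : 0 ≤ ∑ e ∈ X ×ˢ X, (|fibForm k (e.2 - e.1)| + |fibForm (k + 1) (e.2 - e.1)|) :=
        Finset.sum_nonneg fun e _ => by positivity
      linarith
    · intro p hp p' hp'
      have := Finset.single_le_sum
        (f := fun e : (ℤ × ℤ) × (ℤ × ℤ) =>
          |fibForm k (e.2 - e.1)| + |fibForm (k + 1) (e.2 - e.1)|)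
        (fun e _ => by positivity) (Finset.mem_product.2 ⟨hp, hp'⟩ : (p, p') ∈ X ×ˢ X)
      simp only at this
      constructor
      · have h1 := neg_abs_le (fibForm k (p' - p))
        have h2 := abs_nonneg (fibForm (k + 1) (p' - p))
        linarith
      · have h1 := neg_abs_le (fibForm (k + 1) (p' - p))
        have h2 := abs_nonneg (fibForm k (p' - p))
        linarith
  have hcone : ∀ q ∈ intGrid (Nat.fib k), ∀ q' ∈ intGrid (Nat.fib k), ∀ p ∈ X, ∀ p' ∈ X,
      goldenCoord q < goldenCoord q' → 0 < fibForm k ((E • q' + p') - (E • q + p)) ∧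
        0 < fibForm (k + 1) ((E • q' + p') - (E • q + p)) := by
    intro q hq q' hq' p hp p' hp' hlt
    obtain ⟨h1, h2⟩ := fibForm_pos_of_mem_intGrid hk hq hq' hlt
    obtain ⟨h3, h4⟩ := hE p hp p' hp'
    have e : (E • q' + p') - (E • q + p) = E • (q' - q) + (p' - p) := by
      rw [smul_sub]; abel
    rw [e, fibForm_add, fibForm_add, fibForm_smul, fibForm_smul]
    constructor <;> nlinarith
  have hlt' : ∀ q ∈ intGrid (Nat.fib k), ∀ q' ∈ intGrid (Nat.fib k), ∀ p ∈ X, ∀ p' ∈ X,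
      goldenCoord q < goldenCoord q' →
        goldenCoord (E • q + p) < goldenCoord (E • q' + p') := by
    intro q hq q' hq' p hp p' hp' hlt
    obtain ⟨h1, h2⟩ := hcone q hq q' hq' p hp p' hp' hlt
    have := goldenCoord_pos_of_fibForm_pos hk h1 h2
    rwa [goldenCoord_sub, sub_pos] at this
  have hinj : ∀ q ∈ intGrid (Nat.fib k), ∀ q' ∈ intGrid (Nat.fib k), ∀ p ∈ X, ∀ p' ∈ X,
      E • q + p = E • q' + p' → q = q' := by
    intro q hq q' hq' p hp p' hp' he
    by_contra hne
    rcases lt_or_gt_of_ne (fun e => hne (goldenCoord_injective e)) with hlt | hlt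
    · exact (hlt' q hq q' hq' p hp p' hp' hlt).ne (by rw [he])
    · exact (hlt' q' hq' q hq p' hp' p hp hlt).ne (by rw [he])
  obtain ⟨pmax, hpmax, hmax⟩ := X.exists_max_image goldenCoord hX
  obtain ⟨pmin, hpmin, hmin⟩ := X.exists_min_image goldenCoord hX
  let X' := (intGrid (Nat.fib k) ×ˢ X).image fun r => E • r.1 + r.2
  let 𝓛₁ := 𝓛.biUnion fun e =>
    ((intGrid (Nat.fib k)).image (fibForm e.1)).image fun v => (e.1, e.2 + E * v)
  let 𝓛₂ := (intGrid (Nat.fib k)).image fun q => (k, fibForm k (E • q + pmax))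
  let 𝓛₃ := (intGrid (Nat.fib k)).image fun q => (k + 1, fibForm (k + 1) (E • q + pmin))
  have hmem : ∀ q ∈ intGrid (Nat.fib k), ∀ p ∈ X, E • q + p ∈ X' := fun q hq p hp =>
    Finset.mem_image.2 ⟨(q, p), Finset.mem_product.2 ⟨hq, hp⟩, rfl⟩
  refine ⟨X', 𝓛₁ ∪ (𝓛₂ ∪ 𝓛₃), ?_, ?_, ?_, ?_⟩
  · refine ⟨E • ((0, 0) : ℤ × ℤ) + pmax, hmem _ ?_ _ hpmax⟩
    simp [intGrid, hN]
  · rw [Finset.card_image_of_injOn, Finset.card_product, card_intGrid]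
    rintro ⟨q, p⟩ hr ⟨q', p'⟩ hr' he
    obtain ⟨hq, hp⟩ := Finset.mem_product.1 hr
    obtain ⟨hq', hp'⟩ := Finset.mem_product.1 hr'
    have hqq := hinj q hq q' hq' p hp p' hp' he
    subst hqq
    simpa using he
  · intro r hr r' hr' hlt hno
    obtain ⟨⟨q, p⟩, hqp, rfl⟩ := Finset.mem_image.1 hr
    obtain ⟨⟨q', p'⟩, hqp', rfl⟩ := Finset.mem_image.1 hr'
    obtain ⟨hq, hp⟩ := Finset.mem_product.1 hqp
    obtain ⟨hq', hp'⟩ := Finset.mem_product.1 hqp'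
    dsimp only at hq hp hq' hp' hlt hno ⊢
    by_cases hqq : q = q'
    · subst hqq
      rw [goldenCoord_add, goldenCoord_add, add_lt_add_iff_left] at hlt
      obtain ⟨k', hk', hk0', h1, h2, h3, h4⟩ := h p hp p' hp' hlt fun s hs hss => by
        refine hno _ (hmem q hq s hs) ?_
        simpa only [goldenCoord_add, add_lt_add_iff_left] using hss
      have hL : ∀ l s, (l, fibForm l s) ∈ 𝓛 → (l, fibForm l (E • q + s)) ∈ 𝓛₁ := by
        intro l s hls
        refine Finset.mem_biUnion.2 ⟨_, hls, Finset.mem_image.2 ⟨_,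
          Finset.mem_image_of_mem _ hq, ?_⟩⟩
        rw [fibForm_add, fibForm_smul, add_comm]
      refine ⟨k', hk', hk0', Finset.mem_union_left _ (hL _ _ h1),
        Finset.mem_union_left _ (hL _ _ h2), ?_, ?_⟩
      · rwa [add_sub_add_left_eq_sub]
      · rwa [add_sub_add_left_eq_sub]
    · have hqlt : goldenCoord q < goldenCoord q' := by
        refine lt_of_le_of_ne (not_lt.1 fun hgt => ?_) fun e => hqq (goldenCoord_injective e)
        exact lt_asymm hlt (hlt' q' hq' q hq p' hp' p hp hgt)
      obtain ⟨h1, h2⟩ := hcone q hq q' hq' p hp p' hp' hqlt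
      have hpm : p = pmax := by
        refine goldenCoord_injective (le_antisymm (hmax p hp) (not_lt.1 fun hgt => ?_))
        exact hno _ (hmem q hq pmax hpmax) ⟨by
          rwa [goldenCoord_add, goldenCoord_add, add_lt_add_iff_left],
          hlt' q hq q' hq' pmax hpmax p' hp' hqlt⟩
      have hpm' : p' = pmin := by
        refine goldenCoord_injective (le_antisymm (not_lt.1 fun hgt => ?_) (hmin p' hp'))
        exact hno _ (hmem q' hq' pmin hpmin) ⟨hlt' q hq q' hq' p hp pmin hpmin hqlt, by
          rwa [goldenCoord_add, goldenCoord_add, add_lt_add_iff_left]⟩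
      refine ⟨k, hk, hk0, ?_, ?_, h1, h2⟩
      · rw [hpm]
        exact Finset.mem_union_right _ (Finset.mem_union_left _ (Finset.mem_image_of_mem _ hq))
      · rw [hpm']
        exact Finset.mem_union_right _ (Finset.mem_union_right _ (Finset.mem_image_of_mem _ hq'))
  · intro M
    have hU : ∀ s t : Finset (ℕ × ℤ),
        ∑ e ∈ s ∪ t, M e.1 ≤ ∑ e ∈ s, M e.1 + ∑ e ∈ t, M e.1 := fun s t => by
      have := Finset.sum_union_inter (s₁ := s) (s₂ := t) (f := fun e => M e.1)
      omega
    have hconst : ∀ (s : Finset (ℕ × ℤ)) (l c : ℕ), (∀ e ∈ s, e.1 = l) → s.card ≤ c →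
        ∑ e ∈ s, M e.1 ≤ M l * c := fun s l c hs hc => by
      rw [Finset.sum_congr rfl fun e he => by rw [hs e he], Finset.sum_const, smul_eq_mul,
        mul_comm]
      exact Nat.mul_le_mul_left _ hc
    have b₁ : ∑ e ∈ 𝓛₁, M e.1 ≤ ∑ e ∈ 𝓛, M e.1 * (Nat.fib k * Nat.fib (e.1 + 2)) := by
      refine (sum_biUnion_le_sum _ _ _).trans (Finset.sum_le_sum fun e _ => ?_)
      refine hconst _ _ _ (fun e' he' => ?_)
        (Finset.card_image_le.trans (card_image_fibForm_intGrid _ _))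
      obtain ⟨v, -, rfl⟩ := Finset.mem_image.1 he'
      rfl
    have b₂ : ∑ e ∈ 𝓛₂, M e.1 ≤ M k * Nat.fib k ^ 2 := by
      refine hconst _ _ _ (fun e he => ?_) (Finset.card_image_le.trans (card_intGrid _).le)
      obtain ⟨v, -, rfl⟩ := Finset.mem_image.1 he
      rfl
    have b₃ : ∑ e ∈ 𝓛₃, M e.1 ≤ M (k + 1) * Nat.fib k ^ 2 := by
      refine hconst _ _ _ (fun e he => ?_) (Finset.card_image_le.trans (card_intGrid _).le)
      obtain ⟨v, -, rfl⟩ := Finset.mem_image.1 he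
      rfl
    have u₁ := hU 𝓛₁ (𝓛₂ ∪ 𝓛₃)
    have u₂ := hU 𝓛₂ 𝓛₃
    calc _ ≤ _ := u₁
      _ ≤ ∑ e ∈ 𝓛, M e.1 * (Nat.fib k * Nat.fib (e.1 + 2)) +
          (M k * Nat.fib k ^ 2 + M (k + 1) * Nat.fib k ^ 2) :=
        add_le_add b₁ (u₂.trans (add_le_add b₂ b₃))
      _ = _ := by ring

theorem exists_fibLinked (S : ℕ) : ∀ k : ℕ → ℕ, (∀ l, Even (k l)) → (∀ l, 0 < k l) →
    ∃ X : Finset (ℤ × ℤ), ∃ 𝓛 : Finset (ℕ × ℤ), X.Nonempty ∧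
      X.card = ∏ l ∈ Finset.range S, Nat.fib (k l) ^ 2 ∧ FibLinked X 𝓛 ∧
      ∀ M : ℕ → ℕ, ∑ e ∈ 𝓛, M e.1 ≤ ∑ l ∈ Finset.range S, Nat.fib (k l) ^ 2 *
        (∏ m ∈ Finset.range l, Nat.fib (k m)) *
        (M (k l) * Nat.fib (k l + 2) ^ l + M (k l + 1) * Nat.fib (k l + 3) ^ l) := by
  induction S with
  | zero =>
    intro k _ _
    refine ⟨{0}, ∅, by simp, by simp, ?_, by simp⟩
    intro p hp p' hp' hlt
    rw [Finset.mem_singleton.1 hp, Finset.mem_singleton.1 hp'] at hlt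
    exact absurd hlt (lt_irrefl _)
  | succ S ih =>
    intro k hk hk0
    obtain ⟨X, 𝓛, hX, hcard, hl, hsum⟩ := ih (fun l => k (l + 1)) (fun l => hk _) fun l => hk0 _
    obtain ⟨X', 𝓛', hX', hcard', hl', hsum'⟩ := exists_fibLinked_step hX hl (hk 0) (hk0 0)
    refine ⟨X', 𝓛', hX', ?_, hl', fun M => (hsum' M).trans ?_⟩
    · rw [hcard', hcard, Finset.prod_range_succ', mul_comm]
    · rw [Finset.sum_range_succ']
      refine add_le_add ((hsum fun l => M l * (Nat.fib (k 0) * Nat.fib (l + 2))).trans ?_) ?_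
      · refine Finset.sum_le_sum fun l _ => le_of_eq ?_
        rw [Finset.prod_range_succ']
        ring
      · simp

theorem exists_cpa_of_fib {d : ℕ} (hd : 1 ≤ d) (S : ℕ) (k : ℕ → ℕ) (hk : ∀ l, Even (k l))
    (hk0 : ∀ l, 0 < k l) (W : ℕ) :
    ∃ f : (Fin d → ℝ) → ℝ, IsCPA f ∧
      (∃ K ≤ (∑ l ∈ Finset.range S, Nat.fib (k l) ^ 2 * (∏ m ∈ Finset.range l, Nat.fib (k m)) *
          (Nat.fib (k l + 2) ^ l + Nat.fib (k l + 3) ^ l) + 2) + 2 * ((d - 1) * W),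
        ∃ g : Fin K → (Fin d → ℝ) → ℝ, (∀ i, IsAffineFn (g i)) ∧ ∀ x, ∃ i, f x = g i x) ∧
      ∃ Ps : Finset (Set (Fin d → ℝ)), (∀ P ∈ Ps, IsMaximalPiece f P) ∧
        (∏ l ∈ Finset.range S, Nat.fib (k l) ^ 2) * W ^ (d - 1) ≤ Ps.card := by
  classical
  obtain ⟨X, 𝓛, hX, hcard, hlink, hsum⟩ := exists_fibLinked S k hk hk0
  have hsum := hsum fun _ => 1
  simp only [Finset.sum_const, smul_eq_mul, mul_one, one_mul] at hsum
  obtain ⟨e₁, m, hm, -, h, hc, hcov, htail, hpk, Y, hY⟩ :=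
    exists_zigzag goldenCoord (fun p => (p.2 : ℝ)) (𝓛.image fibLine) X hX
      (fun p _ q _ he => goldenCoord_injective he) hlink.exists_lines
  let e₂ : ℝ × ℝ := (-1, m.2 + goldenCoord m)
  obtain ⟨f, hf, ⟨K, hK, hg⟩, Ps, hPs, hPc⟩ := exists_cpa_of_peaks hd hc
    (insert e₂ (insert e₁ (𝓛.image fibLine)))
    (fun t => by
      rcases le_total t (goldenCoord m) with ht | ht
      · obtain ⟨e, he, hte⟩ := hcov t ht
        exact ⟨e, Finset.mem_insert_of_mem he, hte⟩
      · exact ⟨e₂, Finset.mem_insert_self _ _, by rw [htail t ht]; simp only [e₂]; ring⟩)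
    (X.image goldenCoord)
    (fun t ht => by
      obtain ⟨p, hp, rfl⟩ := Finset.mem_image.1 ht
      exact hpk p hp) Y hY W
  refine ⟨f, hf, ⟨K, hK.trans ?_, hg⟩, Ps, hPs, ?_⟩
  · have h1 := Finset.card_insert_le e₂ (insert e₁ (𝓛.image fibLine))
    have h2 := Finset.card_insert_le e₁ (𝓛.image fibLine)
    have h3 := Finset.card_image_le (s := 𝓛) (f := fibLine)
    omega
  · rwa [Finset.card_image_of_injective _ goldenCoord_injective, hcard] at hPc

theorem fib_le_goldenRatio_pow (k : ℕ) : (Nat.fib k : ℝ) ≤ φ ^ k := by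
  induction k using Nat.twoStepInduction with
  | zero => simp
  | one => simpa using Real.one_lt_goldenRatio.le
  | more k h0 h1 =>
    rw [Nat.fib_add_two, pow_add, Real.goldenRatio_sq]
    push_cast
    rw [pow_succ] at h1
    linarith

theorem goldenRatio_pow_le_fib (k : ℕ) : φ ^ k ≤ Nat.fib (k + 2) := by
  induction k using Nat.twoStepInduction with
  | zero => simp
  | one => simpa [Nat.fib_add_two] using Real.goldenRatio_lt_two.le
  | more k h0 h1 =>
    rw [Nat.fib_add_two, pow_add, Real.goldenRatio_sq]
    push_cast
    rw [pow_succ] at h1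
    linarith

/-- The Fibonacci index of the grid used at level `l` of a construction with `S` levels. -/
def levelIndex (S l : ℕ) : ℕ := 2 * (S ^ 2 / (2 * ((l + 1) * (l + 2)))) + 2

theorem levelIndex_le (S l : ℕ) :
    (levelIndex S l : ℝ) ≤ (S : ℝ) ^ 2 * (1 / (l + 1) - 1 / (l + 2)) + 2 := by
  have h : ((S ^ 2 / (2 * ((l + 1) * (l + 2))) : ℕ) : ℝ) ≤ _ := Nat.cast_div_le
  push_cast at h
  have e : (S : ℝ) ^ 2 * (1 / (l + 1) - 1 / (l + 2)) =
      2 * ((S : ℝ) ^ 2 / (2 * ((l + 1) * (l + 2)))) := by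
    field_simp; ring
  rw [e]
  simp only [levelIndex]
  push_cast
  linarith

theorem le_levelIndex (S l : ℕ) :
    (S : ℝ) ^ 2 * (1 / (l + 1) - 1 / (l + 2)) ≤ levelIndex S l := by
  have h : S ^ 2 < (2 * ((l + 1) * (l + 2))) * (S ^ 2 / (2 * ((l + 1) * (l + 2))) + 1) :=
    Nat.lt_mul_div_succ _ (by positivity)
  have h : ((S ^ 2 : ℕ) : ℝ) ≤ ((2 * ((l + 1) * (l + 2)) : ℕ) : ℝ) *
      ((S ^ 2 / (2 * ((l + 1) * (l + 2))) + 1 : ℕ) : ℝ) := by exact_mod_cast h.le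
  have e : (S : ℝ) ^ 2 * (1 / (l + 1) - 1 / (l + 2)) =
      (S : ℝ) ^ 2 / ((l + 1) * (l + 2)) := by
    field_simp; ring
  rw [e, div_le_iff₀ (by positivity)]
  simp only [levelIndex]
  rw [Nat.cast_add, Nat.cast_mul]
  rw [Nat.cast_add, Nat.cast_mul] at h
  push_cast at h ⊢
  linarith

theorem sum_levelIndex_le (S l : ℕ) : ∑ m ∈ Finset.range l, (levelIndex S m : ℝ) ≤
    (S : ℝ) ^ 2 * (1 - 1 / (l + 1)) + 2 * l := by
  induction l with
  | zero => simp
  | succ l ih =>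
    rw [Finset.sum_range_succ]
    have := levelIndex_le S l
    push_cast
    rw [add_assoc (l : ℝ) 1 1, one_add_one_eq_two]
    linarith

theorem le_sum_levelIndex (S l : ℕ) : (S : ℝ) ^ 2 * (1 - 1 / (l + 1)) ≤
    ∑ m ∈ Finset.range l, (levelIndex S m : ℝ) := by
  induction l with
  | zero => simp
  | succ l ih =>
    rw [Finset.sum_range_succ]
    have := le_levelIndex S l
    push_cast
    rw [add_assoc (l : ℝ) 1 1, one_add_one_eq_two]
    linarith

theorem levelIndex_exponent_le (S l : ℕ) :
    (l + 2) * levelIndex S l + ∑ m ∈ Finset.range l, levelIndex S m ≤ S ^ 2 + 4 * l + 4 := by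
  have h1 := mul_le_mul_of_nonneg_left (levelIndex_le S l) (show (0 : ℝ) ≤ l + 2 by positivity)
  have h2 := sum_levelIndex_le S l
  have e : ((l : ℝ) + 2) * ((S : ℝ) ^ 2 * (1 / (l + 1) - 1 / (l + 2)) + 2) =
      (S : ℝ) ^ 2 * (1 / (l + 1)) + 2 * l + 4 := by
    field_simp; ring
  rw [e] at h1
  have : (((l + 2) * levelIndex S l + ∑ m ∈ Finset.range l, levelIndex S m : ℕ) : ℝ) ≤
      ((S ^ 2 + 4 * l + 4 : ℕ) : ℝ) := by
    push_cast
    linarith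
  exact_mod_cast this

theorem line_count_le (S : ℕ) :
    ((∑ l ∈ Finset.range S, Nat.fib (levelIndex S l) ^ 2 *
      (∏ m ∈ Finset.range l, Nat.fib (levelIndex S m)) *
      (Nat.fib (levelIndex S l + 2) ^ l + Nat.fib (levelIndex S l + 3) ^ l) + 2 : ℕ) : ℝ) ≤
      φ ^ (S ^ 2 + 9 * S + 8) := by
  have hφ := Real.one_lt_goldenRatio.le
  have hφ0 := Real.goldenRatio_pos.le
  have hterm : ∀ l ∈ Finset.range S, (Nat.fib (levelIndex S l) : ℝ) ^ 2 *
      (∏ m ∈ Finset.range l, (Nat.fib (levelIndex S m) : ℝ)) *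
      ((Nat.fib (levelIndex S l + 2) : ℝ) ^ l + (Nat.fib (levelIndex S l + 3) : ℝ) ^ l) ≤
      2 * φ ^ (S ^ 2 + 7 * S + 4) := by
    intro l hl
    have hlS := Finset.mem_range.1 hl
    have h1 : (Nat.fib (levelIndex S l) : ℝ) ^ 2 ≤ φ ^ (2 * levelIndex S l) := by
      rw [mul_comm, pow_mul]
      exact pow_le_pow_left₀ (by positivity) (fib_le_goldenRatio_pow _) _
    have h2 : (∏ m ∈ Finset.range l, (Nat.fib (levelIndex S m) : ℝ)) ≤
        φ ^ (∑ m ∈ Finset.range l, levelIndex S m) := by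
      rw [← Finset.prod_pow_eq_pow_sum]
      exact Finset.prod_le_prod (fun _ _ => by positivity) fun _ _ => fib_le_goldenRatio_pow _
    have h3 : (Nat.fib (levelIndex S l + 2) : ℝ) ^ l ≤ φ ^ ((levelIndex S l + 3) * l) := by
      rw [pow_mul]
      exact pow_le_pow_left₀ (by positivity) ((fib_le_goldenRatio_pow _).trans
        (pow_le_pow_right₀ hφ (by omega))) _
    have h4 : (Nat.fib (levelIndex S l + 3) : ℝ) ^ l ≤ φ ^ ((levelIndex S l + 3) * l) := by
      rw [pow_mul]
      exact pow_le_pow_left₀ (by positivity) (fib_le_goldenRatio_pow _) _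
    calc _ ≤ φ ^ (2 * levelIndex S l) * φ ^ (∑ m ∈ Finset.range l, levelIndex S m) *
          (φ ^ ((levelIndex S l + 3) * l) + φ ^ ((levelIndex S l + 3) * l)) := by
          gcongr
      _ = 2 * φ ^ ((l + 2) * levelIndex S l + ∑ m ∈ Finset.range l, levelIndex S m +
          3 * l) := by
          rw [← two_mul, ← pow_add, mul_left_comm, ← pow_add]
          congr 2
          ring
      _ ≤ _ := by
          refine mul_le_mul_of_nonneg_left (pow_le_pow_right₀ hφ ?_) two_pos.le
          have := levelIndex_exponent_le S l
          omega
  have hsum := Finset.sum_le_card_nsmul _ _ _ hterm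
  rw [Finset.card_range, nsmul_eq_mul] at hsum
  have hS : (S : ℝ) + 1 ≤ φ ^ (2 * S) := by
    rw [pow_mul, Real.goldenRatio_sq]
    have := one_add_mul_le_pow (show (-2 : ℝ) ≤ φ by linarith) S
    calc (S : ℝ) + 1 ≤ 1 + S * φ := by nlinarith [Nat.cast_nonneg (α := ℝ) S]
      _ ≤ (1 + φ) ^ S := this
      _ = _ := by rw [add_comm]
  have h2 : (2 : ℝ) ≤ φ ^ 2 := by rw [Real.goldenRatio_sq]; linarith
  have h1 : 1 ≤ φ ^ (S ^ 2 + 7 * S + 4) := one_le_pow₀ hφ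
  push_cast
  calc _ ≤ (S : ℝ) * (2 * φ ^ (S ^ 2 + 7 * S + 4)) + 2 := by linarith
    _ ≤ 2 * (S + 1) * φ ^ (S ^ 2 + 7 * S + 4) := by linarith
    _ ≤ φ ^ 2 * φ ^ (2 * S) * φ ^ (S ^ 2 + 7 * S + 4) := by gcongr
    _ = φ ^ (S ^ 2 + 9 * S + 6) := by rw [← pow_add, ← pow_add]; congr 1; ring
    _ ≤ _ := pow_le_pow_right₀ hφ (by omega)

theorem le_point_count (S : ℕ) : φ ^ (2 * (S : ℝ) ^ 2 - 6 * S) ≤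
    ((∏ l ∈ Finset.range S, Nat.fib (levelIndex S l) ^ 2 : ℕ) : ℝ) := by
  have hφ := Real.one_lt_goldenRatio.le
  have hfib : ∀ l, φ ^ (levelIndex S l - 2) ≤ Nat.fib (levelIndex S l) := fun l => by
    have : levelIndex S l - 2 + 2 = levelIndex S l := by simp [levelIndex]
    simpa [this] using goldenRatio_pow_le_fib (levelIndex S l - 2)
  have h1 : φ ^ (∑ l ∈ Finset.range S, (levelIndex S l - 2) * 2) ≤
      ((∏ l ∈ Finset.range S, Nat.fib (levelIndex S l) ^ 2 : ℕ) : ℝ) := by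
    rw [← Finset.prod_pow_eq_pow_sum]
    push_cast
    refine Finset.prod_le_prod (fun _ _ => by positivity) fun l _ => ?_
    rw [pow_mul]
    exact pow_le_pow_left₀ (by positivity) (hfib l) _
  refine le_trans ?_ h1
  rw [← Real.rpow_natCast φ]
  refine Real.rpow_le_rpow_of_exponent_le hφ ?_
  have h2 := le_sum_levelIndex S S
  have e : ((∑ l ∈ Finset.range S, (levelIndex S l - 2) * 2 : ℕ) : ℝ) =
      2 * ∑ l ∈ Finset.range S, (levelIndex S l : ℝ) - 4 * S := by
    have : ∀ l, (((levelIndex S l - 2) * 2 : ℕ) : ℝ) = 2 * levelIndex S l - 4 := fun l => by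
      rw [Nat.cast_mul, Nat.cast_sub (by simp [levelIndex])]
      push_cast; ring
    rw [Nat.cast_sum, Finset.sum_congr rfl fun l _ => this l, Finset.sum_sub_distrib,
      ← Finset.mul_sum, Finset.sum_const, Finset.card_range, nsmul_eq_mul]
    ring
  rw [e]
  have h3 : (S : ℝ) ^ 2 - S ≤ (S : ℝ) ^ 2 * (1 - 1 / (S + 1)) := by
    have h0 : (0 : ℝ) ≤ S := Nat.cast_nonneg S
    have : (S : ℝ) ^ 2 * (1 - 1 / (S + 1)) - (S ^ 2 - S) = S / (S + 1) := by
      field_simp; ring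
    have := div_nonneg h0 (show (0 : ℝ) ≤ S + 1 by positivity)
    linarith
  linarith

theorem exists_cpa_trivial (d : ℕ) {n : ℕ} (hn : 2 ≤ n) :
    ∃ f : (Fin d → ℝ) → ℝ, IsCPA f ∧
      (∃ k : ℕ, k ≤ n ∧
        ∃ g : Fin k → (Fin d → ℝ) → ℝ, (∀ i, IsAffineFn (g i)) ∧ ∀ x, ∃ i, f x = g i x) ∧
      ∃ Ps : Finset (Set (Fin d → ℝ)), (∀ P ∈ Ps, IsMaximalPiece f P) ∧ 1 ≤ Ps.card := by
  have h0 : IsAffineFn fun _ : Fin d → ℝ => (0 : ℝ) := ⟨0, 0, by simp⟩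
  refine ⟨fun _ => 0, isCPA_of_finset continuous_const {fun _ => 0} (by simpa using h0) (by simp),
    ⟨1, by omega, fun _ _ => 0, fun _ => h0, fun _ => ⟨0, rfl⟩⟩,
    {connectedComponentIn (interior {x | (fun _ : Fin d → ℝ => (0 : ℝ)) x =
      (fun _ : Fin d → ℝ => (0 : ℝ)) x}) 0}, ?_, by simp⟩
  intro P hP
  rw [Finset.mem_singleton.1 hP]
  exact isMaximalPiece_connectedComponentIn h0 (Eventually.of_forall fun _ => rfl)

/-- A number of levels for which the construction uses at most `n / 2` lines and has almost
`n ^ 2` peaks. -/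
theorem exists_level_count {n : ℕ} (hn : 2 ≤ n) (hr : 7 ≤ √(Real.log n / Real.log φ)) :
    ∃ S : ℕ, φ ^ (S ^ 2 + 9 * S + 8) ≤ (n : ℝ) / 2 ∧
      (n : ℝ) ^ (2 - 34 / √(Real.logb 2 n)) ≤ φ ^ (2 * (S : ℝ) ^ 2 - 6 * S) := by
  set μ := Real.log n / Real.log φ with hμ
  set r := √μ with hrdef
  have hφ1 := Real.one_lt_goldenRatio
  have hφ0 := Real.goldenRatio_pos
  have hlogφ : 0 < Real.log φ := Real.log_pos hφ1
  have hn1 : (1 : ℝ) < n := by exact_mod_cast hn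
  have hn0 : (0 : ℝ) < n := by linarith
  have hlogn : 0 < Real.log n := Real.log_pos hn1
  have hμ0 : 0 < μ := div_pos hlogn hlogφ
  have hr2 : r ^ 2 = μ := Real.sq_sqrt hμ0.le
  have hnφ : (n : ℝ) = φ ^ μ := by
    rw [Real.rpow_def_of_pos hφ0, hμ, mul_div_cancel₀ _ hlogφ.ne', Real.exp_log hn0]
  obtain ⟨S, hS1, hS2⟩ : ∃ S : ℕ, (S : ℝ) ≤ r - 6 ∧ r - 7 ≤ S := by
    refine ⟨⌊r - 6⌋₊, Nat.floor_le (by linarith), ?_⟩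
    have := Nat.lt_floor_add_one (r - 6)
    linarith
  have hS0 : (0 : ℝ) ≤ S := Nat.cast_nonneg S
  refine ⟨S, ?_, ?_⟩
  · rw [le_div_iff₀ two_pos]
    have h2 : (2 : ℝ) ≤ φ ^ 2 := by rw [Real.goldenRatio_sq]; linarith
    calc φ ^ (S ^ 2 + 9 * S + 8) * 2 ≤ φ ^ (S ^ 2 + 9 * S + 8) * φ ^ 2 := by gcongr
      _ = φ ^ (((S ^ 2 + 9 * S + 8 + 2 : ℕ) : ℝ)) := by rw [← pow_add, Real.rpow_natCast]
      _ ≤ φ ^ μ := by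
        refine Real.rpow_le_rpow_of_exponent_le hφ1.le ?_
        push_cast
        nlinarith
      _ = n := hnφ.symm
  · have hlog2 : 0 < Real.log 2 := Real.log_pos one_lt_two
    have hlr : √(Real.logb 2 n) ≤ r := by
      refine Real.sqrt_le_sqrt ?_
      rw [Real.logb, hμ]
      exact div_le_div_of_nonneg_left hlogn.le hlogφ
        (Real.log_le_log hφ0 Real.goldenRatio_lt_two.le)
    have hl0 : 0 < √(Real.logb 2 n) := Real.sqrt_pos.2 (div_pos hlogn hlog2)
    have h34 : 34 / r ≤ 34 / √(Real.logb 2 n) :=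
      div_le_div_of_nonneg_left (by norm_num) hl0 hlr
    calc (n : ℝ) ^ (2 - 34 / √(Real.logb 2 n)) ≤ (n : ℝ) ^ (2 - 34 / r) :=
          Real.rpow_le_rpow_of_exponent_le hn1.le (by linarith)
      _ = φ ^ (μ * (2 - 34 / r)) := by rw [Real.rpow_mul hφ0.le, ← hnφ]
      _ ≤ _ := by
        refine Real.rpow_le_rpow_of_exponent_le hφ1.le ?_
        have : μ * (2 - 34 / r) = 2 * r ^ 2 - 34 * r := by
          rw [← hr2]
          have : r ≠ 0 := by linarith
          field_simp
        rw [this]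
        nlinarith

/-- For every `d ≥ 1` there are constants `β, c > 0` such that for every
`n ≥ 2` there is a CPA function `f : ℝ^d → ℝ` with at most `n` affine components
(`k ≤ n` affine functions covering `f`) and at least `β · n^(d + 1 - c/√(log₂ n))`
pairwise distinct maximal pieces. -/
theorem cpa_lower_bound_main (d : ℕ) (hd : 1 ≤ d) :
    ∃ β c : ℝ, 0 < β ∧ 0 < c ∧ ∀ n : ℕ, 2 ≤ n →
      ∃ f : (Fin d → ℝ) → ℝ, IsCPA f ∧
        (∃ k : ℕ, k ≤ n ∧
          ∃ g : Fin k → (Fin d → ℝ) → ℝ, (∀ i, IsAffineFn (g i)) ∧ ∀ x, ∃ i, f x = g i x) ∧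
        ∃ Ps : Finset (Set (Fin d → ℝ)), (∀ P ∈ Ps, IsMaximalPiece f P) ∧
          β * (n : ℝ) ^ ((d : ℝ) + 1 - c / Real.sqrt (Real.logb 2 n)) ≤ Ps.card := by
  have hd' : (1 : ℝ) ≤ d := by exact_mod_cast hd
  have hβ0 : (0 : ℝ) < (1 / (8 * d)) ^ (d - 1) := by positivity
  have hβ1 : (1 / (8 * (d : ℝ))) ^ (d - 1) ≤ 1 := by
    refine pow_le_one₀ (by positivity) ?_
    rw [div_le_one (by positivity)]
    linarith
  refine ⟨(1 / (8 * d)) ^ (d - 1), (d + 1) * (4 * d + 7) + 34, hβ0, by positivity,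
    fun n hn => ?_⟩
  have hn1 : (1 : ℝ) < n := by exact_mod_cast hn
  have hn0 : (0 : ℝ) < n := by linarith
  have hlogn : 0 < Real.log n := Real.log_pos hn1
  have hlog2 : 0 < Real.log 2 := Real.log_pos one_lt_two
  have hl0 : 0 < √(Real.logb 2 n) := Real.sqrt_pos.2 (div_pos hlogn hlog2)
  by_cases hsmall : √(Real.logb 2 n) ≤ 4 * d + 7
  · obtain ⟨f, hf, hg, Ps, hPs, hcard⟩ := exists_cpa_trivial d hn
    refine ⟨f, hf, hg, Ps, hPs, ?_⟩
    have hexp : (d : ℝ) + 1 - ((d + 1) * (4 * d + 7) + 34) / √(Real.logb 2 n) ≤ 0 := by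
      rw [sub_nonpos, le_div_iff₀ hl0]
      nlinarith
    have h1 := Real.rpow_le_one_of_one_le_of_nonpos hn1.le hexp
    have h2 : (1 : ℝ) ≤ Ps.card := by exact_mod_cast hcard
    exact (mul_le_one₀ hβ1 (Real.rpow_nonneg hn0.le _) h1).trans h2
  have hlarge := not_le.1 hsmall
  have hr : 7 ≤ √(Real.log n / Real.log φ) := by
    refine le_trans (by linarith) (hlarge.le.trans (Real.sqrt_le_sqrt ?_))
    exact div_le_div_of_nonneg_left hlogn.le (Real.log_pos Real.one_lt_goldenRatio)
      (Real.log_le_log Real.goldenRatio_pos Real.goldenRatio_lt_two.le)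
  have hnd : 4 * d ≤ n := by
    have h1 : (4 * (d : ℝ)) ^ 2 ≤ Real.logb 2 n := by
      have hb : 0 ≤ Real.logb 2 n := (div_pos hlogn hlog2).le
      rw [← Real.sq_sqrt hb]
      exact pow_le_pow_left₀ (by positivity) (by linarith) 2
    have h2 : Real.logb 2 n ≤ n := by
      rw [Real.logb_le_iff_le_rpow one_lt_two hn0, Real.rpow_natCast]
      exact_mod_cast n.lt_two_pow_self.le
    have : (4 * (d : ℝ)) ≤ n := by nlinarith
    exact_mod_cast this
  obtain ⟨S, hS1, hS2⟩ := exists_level_count hn hr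
  obtain ⟨f, hf, ⟨k, hk, hg⟩, Ps, hPs, hcard⟩ := exists_cpa_of_fib hd S (levelIndex S)
    (fun l => by simp [levelIndex, parity_simps]) (fun l => by simp [levelIndex]) (n / (4 * d))
  refine ⟨f, hf, ⟨k, ?_, hg⟩, Ps, hPs, ?_⟩
  · have h1 := (line_count_le S).trans hS1
    rw [le_div_iff₀ two_pos] at h1
    have h1 := Nat.cast_le (α := ℝ).1 (by push_cast at h1 ⊢; exact h1 :
      (((∑ l ∈ Finset.range S, Nat.fib (levelIndex S l) ^ 2 *
        (∏ m ∈ Finset.range l, Nat.fib (levelIndex S m)) *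
        (Nat.fib (levelIndex S l + 2) ^ l + Nat.fib (levelIndex S l + 3) ^ l) + 2) * 2 : ℕ) : ℝ) ≤
          (n : ℕ))
    have h2 : 4 * d * (n / (4 * d)) ≤ n := Nat.mul_div_le _ _
    have h3 : (d - 1) * (n / (4 * d)) ≤ d * (n / (4 * d)) :=
      Nat.mul_le_mul_right _ (Nat.sub_le _ _)
    rw [mul_assoc] at h2
    omega
  · have hW : (1 / (8 * d)) * (n : ℝ) ≤ ((n / (4 * d) : ℕ) : ℝ) := by
      have h1 : n < 4 * d * (n / (4 * d) + 1) := Nat.lt_mul_div_succ _ (by omega)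
      have h2 : 1 ≤ n / (4 * d) := (Nat.one_le_div_iff (by omega)).2 hnd
      have h3 : n ≤ 8 * d * (n / (4 * d)) := by nlinarith
      rw [one_div_mul_eq_div, div_le_iff₀ (by positivity), mul_comm]
      exact_mod_cast h3
    have hc : (n : ℝ) ^ ((d : ℝ) + 1 - ((d + 1) * (4 * d + 7) + 34) / √(Real.logb 2 n)) ≤
        (n : ℝ) ^ (2 - 34 / √(Real.logb 2 n)) * (n : ℝ) ^ (d - 1) := by
      rw [← Real.rpow_natCast, ← Real.rpow_add hn0, Nat.cast_sub hd]
      refine Real.rpow_le_rpow_of_exponent_le hn1.le ?_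
      have : 34 / √(Real.logb 2 n) ≤ ((d + 1) * (4 * d + 7) + 34) / √(Real.logb 2 n) :=
        div_le_div_of_nonneg_right (by nlinarith) hl0.le
      push_cast
      linarith
    have hP := hS2.trans (le_point_count S)
    calc _ ≤ (1 / (8 * d)) ^ (d - 1) * ((n : ℝ) ^ (2 - 34 / √(Real.logb 2 n)) *
          (n : ℝ) ^ (d - 1)) := mul_le_mul_of_nonneg_left hc hβ0.le
      _ = (n : ℝ) ^ (2 - 34 / √(Real.logb 2 n)) * ((1 / (8 * d)) * (n : ℝ)) ^ (d - 1) := by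
        rw [mul_pow]; ring
      _ ≤ ((∏ l ∈ Finset.range S, Nat.fib (levelIndex S l) ^ 2 : ℕ) : ℝ) *
          ((n / (4 * d) : ℕ) : ℝ) ^ (d - 1) :=
        mul_le_mul hP (pow_le_pow_left₀ (by positivity) hW _) (by positivity) (by positivity)
      _ ≤ Ps.card := by exact_mod_cast hcard
end

section
/- Let H_1, …, H_n be n affine hyperplanes in ℝ^d (each of the form {x : ⟨a_i, x⟩ = b_i} with a_i ≠ 0). Then the number of connected components of ℝ^d \ (H_1 ∪ ⋯ ∪ H_n) is at most Σ_{k=0}^{d} C(n, k), where C(·,·) denotes the binomial coefficient. -/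
open Classical in
/-- The indices `i` for which `x` lies strictly on the positive side of `a i ⬝ᵥ y = b i`. -/
noncomputable def positiveSide {ι κ : Type*} [Fintype ι] [Fintype κ] (a : ι → κ → ℝ) (b : ι → ℝ)
    (x : κ → ℝ) : Finset ι :=
  {i | b i < a i ⬝ᵥ x}

section

variable {ι κ : Type*} [Fintype ι] [Fintype κ] {a : ι → κ → ℝ} {b : ι → ℝ}

lemma mem_positiveSide {x : κ → ℝ} {i : ι} : i ∈ positiveSide a b x ↔ b i < a i ⬝ᵥ x := by
  simp [positiveSide]

/-- A family of positive sides of points off the hyperplanes shatters no set carrying a nontrivial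
linear relation `∑ c i • a i = 0` with `0 ≤ ∑ c i * b i`. -/
lemma not_shatters_of_relation [DecidableEq ι] {𝒜 : Finset (Finset ι)}
    (h𝒜 : ∀ S ∈ 𝒜, ∃ x, (∀ i, a i ⬝ᵥ x ≠ b i) ∧ positiveSide a b x = S)
    {s : Finset ι} {c : ι → ℝ} (hc : ∑ i ∈ s, c i • a i = 0) (hne : ∃ i ∈ s, c i ≠ 0)
    (hb : 0 ≤ ∑ i ∈ s, c i * b i) : ¬ 𝒜.Shatters s := by
  intro hs
  obtain ⟨u, hu, hsu⟩ := hs (Finset.filter_subset (fun i ↦ 0 < c i) s)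
  obtain ⟨x, hx, rfl⟩ := h𝒜 u hu
  have side (i) (hi : i ∈ s) : b i < a i ⬝ᵥ x ↔ 0 < c i := by
    simpa [hi, mem_positiveSide] using Finset.ext_iff.1 hsu i
  have pos (i) (hi : i ∈ s) (hci : c i ≠ 0) : 0 < c i * (a i ⬝ᵥ x - b i) := by
    rcases hci.lt_or_gt with h | h
    · have : a i ⬝ᵥ x < b i :=
        lt_of_le_of_ne (not_lt.1 fun h' ↦ h.not_gt ((side i hi).1 h')) (hx i)
      exact mul_pos_of_neg_of_neg h (sub_neg.2 this)
    · exact mul_pos h (sub_pos.2 ((side i hi).2 h))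
  obtain ⟨i, hi, hci⟩ := hne
  have total : 0 < ∑ i ∈ s, c i * (a i ⬝ᵥ x - b i) := by
    refine Finset.sum_pos' (fun j hj ↦ ?_) ⟨i, hi, pos i hi hci⟩
    by_cases h : c j = 0
    · simp [h]
    · exact (pos j hj h).le
  have zero : ∑ i ∈ s, c i * (a i ⬝ᵥ x) = 0 := by
    simpa [sum_dotProduct] using congrArg (· ⬝ᵥ x) hc
  simp only [mul_sub, Finset.sum_sub_distrib, zero] at total
  linarith

lemma card_le_of_shatters [DecidableEq ι] {𝒜 : Finset (Finset ι)}
    (h𝒜 : ∀ S ∈ 𝒜, ∃ x, (∀ i, a i ⬝ᵥ x ≠ b i) ∧ positiveSide a b x = S)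
    {s : Finset ι} (hs : 𝒜.Shatters s) : s.card ≤ Fintype.card κ := by
  by_contra! hcard
  have dep : ¬ LinearIndepOn ℝ a (s : Set ι) := fun h ↦ by
    have := LinearIndependent.fintype_card_le_finrank h
    simp at this
    omega
  rw [linearIndepOn_finset_iff] at dep
  push Not at dep
  obtain ⟨c, hc, hne⟩ := dep
  rcases le_total 0 (∑ i ∈ s, c i * b i) with h | h
  · exact not_shatters_of_relation h𝒜 hc hne h hs
  · refine not_shatters_of_relation (c := -c) h𝒜 ?_ (by simpa using hne) ?_ hs
    · simp [hc]
    · simpa using h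

/-- Points off the hyperplanes have at most `∑_{k ≤ d} C(n, k)` different positive sides. -/
lemma card_positiveSides_le {𝒜 : Finset (Finset ι)}
    (h𝒜 : ∀ S ∈ 𝒜, ∃ x, (∀ i, a i ⬝ᵥ x ≠ b i) ∧ positiveSide a b x = S) :
    𝒜.card ≤ ∑ k ∈ Finset.range (Fintype.card κ + 1), (Fintype.card ι).choose k := by
  classical
  have hdim : 𝒜.vcDim ≤ Fintype.card κ :=
    Finset.sup_le fun s hs ↦ card_le_of_shatters h𝒜 (Finset.mem_shatterer.1 hs)
  refine (𝒜.card_le_card_shatterer.trans Finset.card_shatterer_le_sum_vcDim).trans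
    (Finset.sum_le_sum_of_subset fun k hk ↦ ?_)
  exact Finset.mem_range_succ_iff.2 ((Finset.mem_Iic.1 hk).trans hdim)

lemma connectedComponentIn_eq_of_positiveSide_eq {x y : κ → ℝ} (hx : ∀ i, a i ⬝ᵥ x ≠ b i)
    (hy : ∀ i, a i ⬝ᵥ y ≠ b i) (h : positiveSide a b x = positiveSide a b y) :
    connectedComponentIn {z | ∀ i, a i ⬝ᵥ z ≠ b i} x =
      connectedComponentIn {z | ∀ i, a i ⬝ᵥ z ≠ b i} y := by
  refine connectedComponentIn_eq ((convex_segment x y).isPreconnected.subset_connectedComponentIn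
    (left_mem_segment ℝ x y) ?_ (right_mem_segment ℝ x y))
  rintro _ ⟨s, t, hs, ht, hst, rfl⟩ i
  have side : b i < a i ⬝ᵥ x ↔ b i < a i ⬝ᵥ y := by
    simpa [mem_positiveSide] using Finset.ext_iff.1 h i
  rw [dotProduct_add, dotProduct_smul, dotProduct_smul]
  rcases (hx i).lt_or_gt with h' | h'
  · have hy' : a i ⬝ᵥ y < b i := lt_of_le_of_ne (not_lt.1 fun h ↦ h'.not_gt (side.2 h)) (hy i)
    exact (convex_Iio (b i) h' hy' hs ht hst).ne
  · exact (convex_Ioi (b i) h' (side.1 h') hs ht hst).ne'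

end


/-- The complement of `n` affine hyperplanes in `ℝ^d` has at most
`Σ_{k=0}^{d} C(n, k)` connected components. -/
theorem hyperplane_arrangement_components {d n : ℕ} (H : Fin n → Set (Fin d → ℝ))
    (hH : ∀ i, ∃ (a : Fin d → ℝ) (b : ℝ), a ≠ 0 ∧
      H i = {x : Fin d → ℝ | (∑ j, a j * x j) = b}) :
    {C : Set (Fin d → ℝ) |
        ∃ x ∈ (⋃ i, H i)ᶜ, C = connectedComponentIn (⋃ i, H i)ᶜ x}.Finite ∧
      {C : Set (Fin d → ℝ) |
        ∃ x ∈ (⋃ i, H i)ᶜ, C = connectedComponentIn (⋃ i, H i)ᶜ x}.ncard ≤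
        ∑ k ∈ Finset.range (d + 1), Nat.choose n k := by
  classical
  choose a b _ hab using hH
  have compl : (⋃ i, H i)ᶜ = {x | ∀ i, a i ⬝ᵥ x ≠ b i} := by
    ext x
    simp [hab, dotProduct]
  rw [compl]
  set U := {x | ∀ i, a i ⬝ᵥ x ≠ b i}
  let 𝒜 : Finset (Finset (Fin n)) := {S | ∃ x ∈ U, positiveSide a b x = S}
  have h𝒜 (S) (hS : S ∈ 𝒜) : ∃ x ∈ U, positiveSide a b x = S := by simpa [𝒜] using hS
  choose! p hpU hp using h𝒜
  have sub : {C | ∃ x ∈ U, C = connectedComponentIn U x} ⊆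
      ↑(𝒜.image fun S ↦ connectedComponentIn U (p S)) := by
    rintro _ ⟨x, hx, rfl⟩
    have hS : positiveSide a b x ∈ 𝒜 := by simpa [𝒜] using ⟨x, hx, rfl⟩
    exact Finset.mem_coe.2 (Finset.mem_image.2
      ⟨_, hS, connectedComponentIn_eq_of_positiveSide_eq (hpU _ hS) hx (hp _ hS)⟩)
  refine ⟨(Finset.finite_toSet _).subset sub, ?_⟩
  calc _ ≤ _ := Set.ncard_le_ncard sub (Finset.finite_toSet _)
    _ ≤ 𝒜.card := by rw [Set.ncard_coe_finset]; exact Finset.card_image_le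
    _ ≤ _ := by
      simpa using card_positiveSides_le fun S hS ↦ ⟨p S, hpU S hS, hp S hS⟩
end

section
/- Let f : ℝ^d → ℝ be continuous and let P₁, P₂ ⊆ ℝ^d be two maximal pieces of f, i.e., open connected sets on which f is affine such that neither can be enlarged: for each Pᵢ there is no nonempty U ⊆ ℝ^d \ Pᵢ with Pᵢ ∪ U open and connected and f affine on Pᵢ ∪ U. Then either P₁ = P₂ or P₁ ∩ P₂ = ∅. -/
theorem IsAffineFn.analyticOnNhd {d : ℕ} {g : (Fin d → ℝ) → ℝ} (hg : IsAffineFn g) :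
    AnalyticOnNhd ℝ g Set.univ := by
  obtain ⟨a, b, h⟩ := hg
  rw [funext h]
  have hproj (i : Fin d) : AnalyticOnNhd ℝ (fun x : Fin d → ℝ => x i) Set.univ :=
    (ContinuousLinearMap.proj (R := ℝ) (φ := fun _ : Fin d => ℝ) i).analyticOnNhd Set.univ
  exact (Finset.univ.analyticOnNhd_fun_sum fun i _ =>
    analyticOnNhd_const.mul (hproj i)).add analyticOnNhd_const

theorem IsAffineFn.eq_of_eqOn {d : ℕ} {g h : (Fin d → ℝ) → ℝ} (hg : IsAffineFn g)
    (hh : IsAffineFn h) {U : Set (Fin d → ℝ)} (hU : IsOpen U) (hne : U.Nonempty)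
    (heq : Set.EqOn g h U) : g = h := by
  obtain ⟨x, hx⟩ := hne
  exact hg.analyticOnNhd.eq_of_eventuallyEq hh.analyticOnNhd
    (heq.eventuallyEq_of_mem (hU.mem_nhds hx))

theorem AffineOnSet.union {d : ℕ} {f : (Fin d → ℝ) → ℝ} {P Q : Set (Fin d → ℝ)}
    (hP : AffineOnSet f P) (hQ : AffineOnSet f Q) (hPo : IsOpen P) (hQo : IsOpen Q)
    (hne : (P ∩ Q).Nonempty) : AffineOnSet f (P ∪ Q) := by
  obtain ⟨g, hg, hfg⟩ := hP
  obtain ⟨h, hh, hfh⟩ := hQ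
  have hgh : g = h := hg.eq_of_eqOn hh (hPo.inter hQo) hne fun x hx =>
    (hfg x hx.1).symm.trans (hfh x hx.2)
  subst hgh
  exact ⟨g, hg, fun x hx => hx.elim (hfg x) (hfh x)⟩

/-- A maximal piece contains every open connected set that meets it and on which `f` is affine. -/
theorem IsMaximalPiece.subset_of_inter_nonempty {d : ℕ} {f : (Fin d → ℝ) → ℝ}
    {P Q : Set (Fin d → ℝ)} (hP : IsMaximalPiece f P) (hQo : IsOpen Q) (hQc : IsConnected Q)
    (hQ : AffineOnSet f Q) (hne : (P ∩ Q).Nonempty) : Q ⊆ P := by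
  obtain ⟨hPo, hPc, hPa, hmax⟩ := hP
  by_contra hQP
  refine hmax ⟨Q \ P, Set.sdiff_nonempty.2 hQP, fun x hx => hx.2, ?_⟩
  rw [Set.union_sdiff_self]
  exact ⟨hPo.union hQo, hPc.union hne hQc, hPa.union hQ hPo hQo hne⟩

/-- Two maximal pieces of a continuous function are either equal or
disjoint. -/
theorem maximalPieces_eq_or_disjoint {d : ℕ} (f : (Fin d → ℝ) → ℝ) (hf : Continuous f)
    (P₁ P₂ : Set (Fin d → ℝ))
    (h₁ : IsMaximalPiece f P₁) (h₂ : IsMaximalPiece f P₂) :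
    P₁ = P₂ ∨ P₁ ∩ P₂ = ∅ := by
  rcases (P₁ ∩ P₂).eq_empty_or_nonempty with hempty | hne
  · exact Or.inr hempty
  · refine Or.inl (Set.Subset.antisymm ?_ ?_)
    · exact h₂.subset_of_inter_nonempty h₁.1 h₁.2.1 h₁.2.2.1 (Set.inter_comm P₁ P₂ ▸ hne)
    · exact h₁.subset_of_inter_nonempty h₂.1 h₂.2.1 h₂.2.2.1 hne
end

section
/- Let f : ℝ^d → ℝ be continuous and let 𝒫 be a finite set of maximal pieces of f such that ℝ^d = ⋃_{P ∈ 𝒫} closure(P). Then for every nonempty open connected set P' ⊆ ℝ^d on which f is affine, there exists P ∈ 𝒫 with P' ⊆ P. -/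
/-- Affine functions commute with `AffineMap.lineMap`. -/
theorem IsAffineFn.apply_lineMap {d : ℕ} {g : (Fin d → ℝ) → ℝ} (hg : IsAffineFn g)
    (x y : Fin d → ℝ) (t : ℝ) :
    g (AffineMap.lineMap x y t) = (1 - t) * g x + t * g y := by
  obtain ⟨a, b, h⟩ := hg
  have hsum : ∑ i, a i * AffineMap.lineMap x y t i
      = (1 - t) * ∑ i, a i * x i + t * ∑ i, a i * y i := by
    simp only [Finset.mul_sum, ← Finset.sum_add_distrib]
    refine Finset.sum_congr rfl fun i _ => ?_
    simp only [AffineMap.lineMap_apply, vsub_eq_sub, vadd_eq_add, Pi.add_apply, Pi.smul_apply,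
      Pi.sub_apply, smul_eq_mul]
    ring
  rw [h, h, h, hsum]
  ring

/-- Affine functions that agree on a nonempty open set are equal. -/
theorem IsAffineFn.eq_of_eqOn_isOpen {d : ℕ} {g g' : (Fin d → ℝ) → ℝ} (hg : IsAffineFn g)
    (hg' : IsAffineFn g') {s : Set (Fin d → ℝ)} (hs : IsOpen s) (hne : s.Nonempty)
    (h : Set.EqOn g g' s) : g = g' := by
  obtain ⟨x, hx⟩ := hne
  funext y
  have hcont : Continuous fun t : ℝ => AffineMap.lineMap x y t := AffineMap.lineMap_continuous
  have hmem : ∀ᶠ t : ℝ in nhdsWithin 0 {0}ᶜ, AffineMap.lineMap x y t ∈ s :=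
    (hcont.continuousAt.eventually_mem (by simpa using hs.mem_nhds hx)).filter_mono
      nhdsWithin_le_nhds
  obtain ⟨t, ht, ht0⟩ := (hmem.and self_mem_nhdsWithin).exists
  have key := h ht
  rw [hg.apply_lineMap, hg'.apply_lineMap, h hx] at key
  exact mul_left_cancel₀ ht0 (add_left_cancel key)

/-- If the closures of a finite set of maximal pieces of a continuous
function `f` cover `ℝ^d`, then every nonempty open connected set on which `f` is affine
is contained in one of these maximal pieces. -/
theorem piece_subset_maximalPiece {d : ℕ} (f : (Fin d → ℝ) → ℝ) (hf : Continuous f)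
    (Ps : Finset (Set (Fin d → ℝ))) (hPs : ∀ P ∈ Ps, IsMaximalPiece f P)
    (hcover : (⋃ P ∈ Ps, closure P) = Set.univ)
    (P' : Set (Fin d → ℝ)) (hne : P'.Nonempty) (hopen : IsOpen P')
    (hconn : IsConnected P') (haff : AffineOnSet f P') :
    ∃ P ∈ Ps, P' ⊆ P := by
  obtain ⟨x, hx⟩ := hne
  obtain ⟨P, hP, hxP⟩ := Set.mem_iUnion₂.1 (hcover.symm ▸ Set.mem_univ x)
  have hmeet : (P ∩ P').Nonempty := by
    rw [Set.inter_comm]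
    exact mem_closure_iff.1 hxP P' hopen hx
  exact ⟨P, hP, (hPs P hP).subset_of_inter_nonempty hopen hconn haff hmeet⟩
end

section
/- Define f : ℝ² → ℝ by f(x, y) = min( y, min( max(−x, −1), max(3 − 2x, −x) ) ). Then: (1) f is CPA; (2) every finite set 𝒫 of open connected subsets of ℝ² with ℝ² = ⋃_{P ∈ 𝒫} closure(P) and f affine on each P ∈ 𝒫 satisfies |𝒫| ≥ 5; and (3) there exist 4 closed connected subsets C₁, C₂, C₃, C₄ of ℝ² with ℝ² = C₁ ∪ C₂ ∪ C₃ ∪ C₄ such that f is affine on each C_i. -/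
/-- The profile of the example: `f (x, y) = min y (profile x)`. -/
noncomputable def profile (x : ℝ) : ℝ :=
  min (max (-x) (-1)) (max (3 - 2 * x) (-x))

theorem continuous_profile : Continuous profile := by
  unfold profile; fun_prop

theorem profile_of_le_one {x : ℝ} (h : x ≤ 1) : profile x = -x := by
  rw [profile, max_eq_left (by linarith), max_eq_left (by linarith), min_eq_left (by linarith)]

theorem profile_of_one_le_of_le_two {x : ℝ} (h₁ : 1 ≤ x) (h₂ : x ≤ 2) : profile x = -1 := by
  rw [profile, max_eq_right (by linarith), max_eq_left (by linarith), min_eq_left (by linarith)]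

theorem profile_of_two_le_of_le_three {x : ℝ} (h₂ : 2 ≤ x) (h₃ : x ≤ 3) :
    profile x = 3 - 2 * x := by
  rw [profile, max_eq_right (by linarith), max_eq_left (by linarith), min_eq_right (by linarith)]

theorem profile_of_three_le {x : ℝ} (h : 3 ≤ x) : profile x = -x := by
  rw [profile, max_eq_right (by linarith), max_eq_right (by linarith), min_eq_right (by linarith)]

theorem neg_le_profile (x : ℝ) : -x ≤ profile x :=
  le_min (le_max_left _ _) (le_max_right _ _)

/-- The homeomorphism `(x, t) ↦ (x, profile x + t)`, which straightens the graph of `profile`. -/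
noncomputable def profileShear : ℝ × ℝ ≃ₜ (Fin 2 → ℝ) where
  toFun p := ![p.1, profile p.1 + p.2]
  invFun z := (z 0, z 1 - profile (z 0))
  left_inv p := by ext <;> simp
  right_inv z := by ext i; fin_cases i <;> simp
  continuous_toFun := by
    have := continuous_profile
    refine continuous_pi fun i => ?_
    fin_cases i <;> simp <;> fun_prop
  continuous_invFun := by
    have := continuous_profile
    fun_prop

/-- The points `(x, profile x + t)` with `x ∈ I` and `t ∈ J`. -/
def shearedBox (I J : Set ℝ) : Set (Fin 2 → ℝ) := profileShear '' (I ×ˢ J)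

theorem mem_shearedBox {I J : Set ℝ} {z : Fin 2 → ℝ} :
    z ∈ shearedBox I J ↔ z 0 ∈ I ∧ z 1 - profile (z 0) ∈ J := by
  rw [shearedBox, ← Homeomorph.coe_toEquiv, Equiv.image_eq_preimage_symm]
  rfl

theorem isOpen_shearedBox {I J : Set ℝ} (hI : IsOpen I) (hJ : IsOpen J) :
    IsOpen (shearedBox I J) :=
  profileShear.isOpenMap _ (hI.prod hJ)

theorem isClosed_shearedBox {I J : Set ℝ} (hI : IsClosed I) (hJ : IsClosed J) :
    IsClosed (shearedBox I J) :=
  profileShear.isClosedMap _ (hI.prod hJ)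

theorem isConnected_shearedBox {I J : Set ℝ} (hI : IsConnected I) (hJ : IsConnected J) :
    IsConnected (shearedBox I J) :=
  (hI.prod hJ).image _ profileShear.continuous.continuousOn

theorem closure_shearedBox (I J : Set ℝ) :
    closure (shearedBox I J) = shearedBox (closure I) (closure J) := by
  rw [shearedBox, ← profileShear.image_closure, closure_prod_eq, shearedBox]

/-- From any point of an open set one can move a little in each coordinate direction. -/
theorem IsOpen.exists_ne_zero_add_single_mem {ι : Type*} [DecidableEq ι] {U : Set (ι → ℝ)}
    (hU : IsOpen U) {p : ι → ℝ} (hp : p ∈ U) (j : ι) : ∃ t : ℝ, t ≠ 0 ∧ p + Pi.single j t ∈ U := by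
  have hcont : Continuous fun t : ℝ => p + Pi.single j t :=
    continuous_const.add (continuous_single (A := fun _ => ℝ) j)
  have hnhds : ∀ᶠ t in nhdsWithin (0 : ℝ) {0}ᶜ, p + Pi.single j t ∈ U :=
    (hcont.continuousAt.eventually_mem (hU.mem_nhds (by simpa using hp))).filter_mono
      nhdsWithin_le_nhds
  obtain ⟨t, ht, ht0⟩ := (hnhds.and self_mem_nhdsWithin).exists
  exact ⟨t, ht0, ht⟩

/-- If two affine maps agree on a nonempty open set, then their coefficients agree. -/
theorem affine_coeffs_eq_of_eqOn_isOpen {d : ℕ} {U : Set (Fin d → ℝ)} (hU : IsOpen U)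
    (hne : U.Nonempty) {a a' : Fin d → ℝ} {b b' : ℝ}
    (h : ∀ x ∈ U, (∑ i, a i * x i) + b = (∑ i, a' i * x i) + b') : a = a' ∧ b = b' := by
  obtain ⟨p, hp⟩ := hne
  have ha : a = a' := by
    funext j
    obtain ⟨t, ht0, ht⟩ := hU.exists_ne_zero_add_single_mem hp j
    have h₁ := h _ ht
    have h₀ := h p hp
    simp only [Pi.add_apply, mul_add, Finset.sum_add_distrib, Pi.single_apply, mul_ite, mul_zero,
      Finset.sum_ite_eq', Finset.mem_univ, if_true] at h₁
    have : a j * t = a' j * t := by linarith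
    exact mul_right_cancel₀ ht0 this
  subst ha
  exact ⟨rfl, by simpa using h p hp⟩

theorem affineOnSet_of_coeffs {f : (Fin 2 → ℝ) → ℝ} {P : Set (Fin 2 → ℝ)} (a : Fin 2 → ℝ) (b : ℝ)
    (h : ∀ x ∈ P, f x = (∑ i, a i * x i) + b) : AffineOnSet f P :=
  ⟨_, ⟨a, b, fun _ => rfl⟩, h⟩

/-- The horizontal extents of the five pieces. -/
def pieceBase : Fin 5 → Set ℝ :=
  ![Set.univ, Set.Iio 1, Set.Ioo 1 2, Set.Ioo 2 3, Set.Ioi 3]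

/-- The vertical extents of the five pieces, relative to the graph of `profile`. -/
def pieceHeight : Fin 5 → Set ℝ :=
  ![Set.Iio 0, Set.Ioi 0, Set.Ioi 0, Set.Ioi 0, Set.Ioi 0]

/-- The five open pieces of the example. -/
def openPiece (i : Fin 5) : Set (Fin 2 → ℝ) := shearedBox (pieceBase i) (pieceHeight i)

/-- The linear coefficients of the example on the five pieces. -/
def pieceSlope : Fin 5 → Fin 2 → ℝ :=
  ![![0, 1], ![-1, 0], ![0, 0], ![-2, 0], ![-1, 0]]

/-- The constant coefficients of the example on the five pieces. -/
def pieceOffset : Fin 5 → ℝ := ![0, 0, -1, 3, 0]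

theorem isOpen_openPiece (i : Fin 5) : IsOpen (openPiece i) := by
  refine isOpen_shearedBox ?_ ?_ <;> fin_cases i <;>
    simp [pieceBase, pieceHeight, isOpen_Iio, isOpen_Ioi, isOpen_Ioo]

theorem isConnected_openPiece (i : Fin 5) : IsConnected (openPiece i) := by
  refine isConnected_shearedBox ?_ ?_ <;> fin_cases i <;>
    norm_num [pieceBase, pieceHeight, isConnected_Iio, isConnected_Ioi, isConnected_Ioo,
      isConnected_univ]

theorem iUnion_closure_openPiece : ⋃ i, closure (openPiece i) = Set.univ := by
  refine Set.eq_univ_of_forall fun z => Set.mem_iUnion.2 ?_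
  simp only [openPiece, closure_shearedBox, mem_shearedBox]
  rcases le_total (z 1) (profile (z 0)) with hy | hy
  · exact ⟨0, by simp [pieceBase, pieceHeight, hy]⟩
  rcases le_total (z 0) 1 with h₁ | h₁
  · exact ⟨1, by simp [pieceBase, pieceHeight, hy, h₁]⟩
  rcases le_total (z 0) 2 with h₂ | h₂
  · exact ⟨2, by simp [pieceBase, pieceHeight, hy, h₁, h₂, closure_Ioo]⟩
  rcases le_total (z 0) 3 with h₃ | h₃
  · exact ⟨3, by simp [pieceBase, pieceHeight, hy, h₂, h₃, closure_Ioo]⟩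
  · exact ⟨4, by simp [pieceBase, pieceHeight, hy, h₃]⟩

/-- The example satisfies the formula prescribed by its coefficients on each closed piece. -/
theorem min_profile_eq_of_mem_closure_openPiece {i : Fin 5} {z : Fin 2 → ℝ}
    (hz : z ∈ closure (openPiece i)) :
    min (z 1) (profile (z 0)) = (∑ j, pieceSlope i j * z j) + pieceOffset i := by
  rw [openPiece, closure_shearedBox, mem_shearedBox] at hz
  fin_cases i <;> simp [pieceBase, pieceHeight, closure_Ioo] at hz <;>
    simp [pieceSlope, pieceOffset]
  · exact hz
  · rw [min_eq_right hz.2, profile_of_le_one hz.1]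
  · rw [min_eq_right hz.2, profile_of_one_le_of_le_two hz.1.1 hz.1.2]
  · rw [min_eq_right hz.2, profile_of_two_le_of_le_three hz.1.1 hz.1.2]; ring
  · rw [min_eq_right hz.2, profile_of_three_le hz.1]

theorem not_forall_min_profile_eq_neg {P : Set (Fin 2 → ℝ)} (hP : IsOpen P)
    (hconn : IsPreconnected P) {p q : Fin 2 → ℝ} (hp : p ∈ P) (hq : q ∈ P) (hp₁ : p 0 ≤ 2)
    (hq₃ : 2 ≤ q 0) : ¬ ∀ z ∈ P, min (z 1) (profile (z 0)) = -z 0 := by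
  intro h
  obtain ⟨r, hr, hr₂⟩ := hconn.intermediate_value hp hq
    (f := fun z : Fin 2 → ℝ => z 0) (by fun_prop) ⟨hp₁, hq₃⟩
  have hline : ∀ t : ℝ, r + Pi.single 1 t ∈ P → r 1 + t = -2 := by
    intro t ht
    have := h _ ht
    simp only [Pi.add_apply, Pi.single_eq_same, ne_eq, zero_ne_one, not_false_eq_true,
      Pi.single_eq_of_ne, add_zero, hr₂,
      profile_of_one_le_of_le_two one_le_two le_rfl] at this
    rcases min_choice (r 1 + t) (-1) with h' | h' <;> linarith
  obtain ⟨t, ht0, ht⟩ := hP.exists_ne_zero_add_single_mem hr 1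
  have h₀ := hline 0 (by simpa using hr)
  have h₁ := hline t ht
  exact ht0 (by linarith)

/-- An open connected set on which the example is affine meets at most one open piece. -/
theorem eq_of_inter_openPiece_nonempty {P : Set (Fin 2 → ℝ)} (hP : IsOpen P)
    (hconn : IsConnected P) (haff : AffineOnSet (fun z => min (z 1) (profile (z 0))) P)
    {i j : Fin 5} (hi : (P ∩ openPiece i).Nonempty) (hj : (P ∩ openPiece j).Nonempty) :
    i = j := by
  obtain ⟨g, ⟨a, b, hg⟩, hfg⟩ := haff
  have hcoeffs : ∀ k, (P ∩ openPiece k).Nonempty → a = pieceSlope k ∧ b = pieceOffset k := by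
    intro k hk
    refine affine_coeffs_eq_of_eqOn_isOpen (hP.inter (isOpen_openPiece k)) hk fun z hz => ?_
    rw [← hg, ← hfg z hz.1, ← min_profile_eq_of_mem_closure_openPiece (subset_closure hz.2)]
  have houter : (P ∩ openPiece 1).Nonempty → (P ∩ openPiece 4).Nonempty → False := by
    rintro ⟨p, hp, hp'⟩ ⟨q, hq, hq'⟩
    obtain ⟨rfl, rfl⟩ := hcoeffs 1 ⟨p, hp, hp'⟩
    have hp₁ := (mem_shearedBox.1 hp').1
    have hq₃ := (mem_shearedBox.1 hq').1
    refine not_forall_min_profile_eq_neg hP hconn.isPreconnected hp hq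
      (le_trans (le_of_lt hp₁) one_le_two)
      (le_trans (by norm_num) (le_of_lt hq₃)) fun z hz => ?_
    refine ((hfg z hz).trans (hg z)).trans ?_
    simp [pieceSlope, pieceOffset]
  obtain ⟨ha, -⟩ := hcoeffs i hi
  obtain ⟨ha', -⟩ := hcoeffs j hj
  have hslope : pieceSlope i 0 = pieceSlope j 0 ∧ pieceSlope i 1 = pieceSlope j 1 := by
    simp [← ha, ← ha']
  by_contra hij
  fin_cases i <;> fin_cases j <;> first
    | exact hij rfl
    | exact houter hi hj
    | exact houter hj hi
    | norm_num [pieceSlope] at hslope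

theorem isPieceSet_image_openPiece [DecidableEq (Set (Fin 2 → ℝ))] :
    IsPieceSet (fun z => min (z 1) (profile (z 0))) (Finset.univ.image openPiece) := by
  refine ⟨fun P hP => ?_, ?_⟩
  · obtain ⟨i, -, rfl⟩ := Finset.mem_image.1 hP
    exact ⟨isOpen_openPiece i, isConnected_openPiece i, affineOnSet_of_coeffs _ _ fun z hz =>
      min_profile_eq_of_mem_closure_openPiece (subset_closure hz)⟩
  · simpa using iUnion_closure_openPiece

theorem five_le_card_of_isPieceSet {Ps : Finset (Set (Fin 2 → ℝ))}
    (hPs : IsPieceSet (fun z => min (z 1) (profile (z 0))) Ps) : 5 ≤ Ps.card := by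
  have hmeet : ∀ i, ∃ P ∈ Ps, (P ∩ openPiece i).Nonempty := by
    intro i
    obtain ⟨z, hz⟩ := (isConnected_openPiece i).nonempty
    have hzPs : z ∈ ⋃ P ∈ Ps, closure P := hPs.2 ▸ Set.mem_univ z
    obtain ⟨P, hP, hzP⟩ := Set.mem_iUnion₂.1 hzPs
    refine ⟨P, hP, ?_⟩
    rw [Set.inter_comm]
    exact mem_closure_iff.1 hzP _ (isOpen_openPiece i) hz
  choose P hP hPmeet using hmeet
  have hinj : Set.InjOn P (Finset.univ : Finset (Fin 5)) := fun i _ j _ hij =>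
    have ⟨hopen, hconn, haff⟩ := hPs.1 _ (hP i)
    eq_of_inter_openPiece_nonempty hopen hconn haff (hPmeet i) (hij ▸ hPmeet j)
  simpa using Finset.card_le_card_of_injOn P (fun i _ => hP i) hinj

/-- The closed set on which the example equals `-x`: two sectors joined by the line `y = -x`. -/
def joinedPiece : Set (Fin 2 → ℝ) :=
  closure (openPiece 1) ∪ {z | z 1 = -z 0} ∪ closure (openPiece 4)

theorem isClosed_joinedPiece : IsClosed joinedPiece :=
  (isClosed_closure.union (isClosed_eq (by fun_prop) (by fun_prop))).union isClosed_closure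

theorem isConnected_joinedPiece : IsConnected joinedPiece := by
  have hline : IsConnected {z : Fin 2 → ℝ | z 1 = -z 0} := by
    have : {z : Fin 2 → ℝ | z 1 = -z 0} = Set.range fun x : ℝ => ![x, -x] := by
      ext z
      refine ⟨fun h => ⟨z 0, ?_⟩, ?_⟩
      · ext i
        fin_cases i
        · rfl
        · exact h.symm
      · rintro ⟨x, rfl⟩
        simp
    rw [this]
    refine isConnected_range (continuous_pi fun i => ?_)
    fin_cases i <;> simp <;> fun_prop
  refine IsConnected.union ⟨![3, -3], ?_, ?_⟩
    (IsConnected.union ⟨![1, -1], ?_, ?_⟩ (isConnected_openPiece 1).closure hline)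
    (isConnected_openPiece 4).closure
  · right; simp
  · simp [openPiece, closure_shearedBox, mem_shearedBox, pieceBase, pieceHeight,
      profile_of_three_le]
  · simp [openPiece, closure_shearedBox, mem_shearedBox, pieceBase, pieceHeight,
      profile_of_le_one]
  · simp

theorem affineOnSet_joinedPiece :
    AffineOnSet (fun z => min (z 1) (profile (z 0))) joinedPiece := by
  refine affineOnSet_of_coeffs (pieceSlope 1) (pieceOffset 1) ?_
  rintro z ((hz | hz) | hz)
  · exact min_profile_eq_of_mem_closure_openPiece hz
  · rw [Set.mem_ofPred_eq] at hz
    simp [pieceSlope, pieceOffset, hz, neg_le_profile]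
  · rw [min_profile_eq_of_mem_closure_openPiece hz]
    simp [pieceSlope, pieceOffset]

/-- For `f(x, y) = min(y, min(max(-x, -1), max(3 - 2x, -x)))` on `ℝ²`:
(1) `f` is CPA; (2) every admissible set of open connected pieces has at least 5
elements; (3) there are 4 closed connected sets covering `ℝ²` on each of which `f` is
affine. -/
theorem bad_piece_example (f : (Fin 2 → ℝ) → ℝ)
    (hf : ∀ z : Fin 2 → ℝ,
      f z = min (z 1) (min (max (-(z 0)) (-1)) (max (3 - 2 * z 0) (-(z 0))))) :
    IsCPA f ∧
    (∀ Ps : Finset (Set (Fin 2 → ℝ)), IsPieceSet f Ps → 5 ≤ Ps.card) ∧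
    (∃ C₁ C₂ C₃ C₄ : Set (Fin 2 → ℝ),
      (IsClosed C₁ ∧ IsClosed C₂ ∧ IsClosed C₃ ∧ IsClosed C₄) ∧
      (IsConnected C₁ ∧ IsConnected C₂ ∧ IsConnected C₃ ∧ IsConnected C₄) ∧
      C₁ ∪ C₂ ∪ C₃ ∪ C₄ = Set.univ ∧
      (AffineOnSet f C₁ ∧ AffineOnSet f C₂ ∧ AffineOnSet f C₃ ∧ AffineOnSet f C₄)) := by
  obtain rfl : f = fun z => min (z 1) (profile (z 0)) := funext hf
  refine ⟨⟨?_, ?_⟩, fun Ps => five_le_card_of_isPieceSet, closure (openPiece 0), joinedPiece,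
    closure (openPiece 2), closure (openPiece 3),
    ⟨isClosed_closure, isClosed_joinedPiece, isClosed_closure, isClosed_closure⟩,
    ⟨(isConnected_openPiece 0).closure, isConnected_joinedPiece,
      (isConnected_openPiece 2).closure, (isConnected_openPiece 3).closure⟩, ?_, ?_⟩
  · have := continuous_profile
    fun_prop
  · classical exact ⟨_, isPieceSet_image_openPiece⟩
  · refine Set.eq_univ_of_forall fun z => ?_
    have hz : z ∈ ⋃ i, closure (openPiece i) := iUnion_closure_openPiece ▸ Set.mem_univ z
    simp only [Set.mem_iUnion, Fin.exists_fin_succ, Fin.exists_fin_zero] at hz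
    simp only [joinedPiece, Set.mem_union]
    tauto
  · have haff : ∀ i, AffineOnSet (fun z => min (z 1) (profile (z 0))) (closure (openPiece i)) :=
      fun i => affineOnSet_of_coeffs _ _ fun z => min_profile_eq_of_mem_closure_openPiece
    exact ⟨haff 0, affineOnSet_joinedPiece, haff 2, haff 3⟩
end
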